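/- arXiv:1703.02841 — 2 statements merged into one kernel-verified Lean document; each statement's English description precedes it below -/
import Mathlib

section
/- Let 1 < p < 2 and β > 0 with βq ≤ 1, where q = p/(p−1). If f ∈ A^1_β(𝕋) and the Hausdorff dimension of Z(f) satisfies dim(Z(f)) < (2/q)(1 − βq), then f is cyclic in A^p_β(𝕋). -/
open MeasureTheory Real Set Filter Topology ENNReal

noncomputable section

instance : Fact (0 < 2 * Real.pi) := ⟨by positivity⟩

/-- The weighted sum `∑ ‖c n‖^p (1+|n|)^{pβ}` of a Fourier-coefficient sequence,
i.e. `‖c‖_{ℓ^p_β}^p`. -/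
def wSum (p β : ℝ) (c : ℤ → ℂ) : ℝ :=
  ∑' n : ℤ, ‖c n‖ ^ p * (1 + |(n : ℝ)|) ^ (p * β)

/-- Membership in `A^p_β(𝕋)` (equivalently `ℓ^p_β(ℤ)`), expressed via the
Fourier coefficient sequence `c`. -/
def MemA (p β : ℝ) (c : ℤ → ℂ) : Prop :=
  Summable fun n : ℤ => ‖c n‖ ^ p * (1 + |(n : ℝ)|) ^ (p * β)

/-- The `A^p_β(𝕋)` (i.e. `ℓ^p_β(ℤ)`) norm of a Fourier-coefficient sequence. -/
def normA (p β : ℝ) (c : ℤ → ℂ) : ℝ := (wSum p β c) ^ (1 / p)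

/-- The function on the circle `𝕋 = ℝ/2πℤ` whose Fourier coefficient sequence is `c`,
namely `t ↦ ∑_{n ∈ ℤ} c_n e^{int}`. -/
def fSum (c : ℤ → ℂ) (t : AddCircle (2 * Real.pi)) : ℂ :=
  ∑' n : ℤ, c n * fourier n t

/-- The zero set `Z(f)` of the function `f` with Fourier coefficients `c`. -/
def zeroSet (c : ℤ → ℂ) : Set (AddCircle (2 * Real.pi)) := {t | fSum c t = 0}

/-- Convolution of coefficient sequences: the Fourier coefficients of the product
of the corresponding functions/distributions. -/
def convSeq (a c : ℤ → ℂ) (n : ℤ) : ℂ := ∑' k : ℤ, a k * c (n - k)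

/-- Cyclicity of (the element with coefficients) `c` in `A^p_β(𝕋)`: there are
trigonometric polynomials `P` (finitely supported coefficient sequences `a`) with
`‖1 - P·f‖_{A^p_β}` arbitrarily small. -/
def IsCyclicA (p β : ℝ) (c : ℤ → ℂ) : Prop :=
  ∀ ε : ℝ, 0 < ε → ∃ a : ℤ → ℂ, (Function.support a).Finite ∧
    normA p β (fun n => (if n = 0 then 1 else 0) - convSeq a c n) < ε

/-- Fourier coefficient `μ̂(n) = ∫ e^{-int} dμ(t)` of a measure on `ℝ/2πℤ`. -/
def muHat (μ : Measure (AddCircle (2 * Real.pi))) (n : ℤ) : ℂ :=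
  ∫ t, fourier (-n) t ∂μ

/-- The `α`-energy `I_α(μ) = ∑_{n ≥ 1} |μ̂(n)|²/(1+n)^{1-α}` of `μ` is finite. -/
def HasFiniteEnergy (α : ℝ) (μ : Measure (AddCircle (2 * Real.pi))) : Prop :=
  Summable fun n : ℕ => ‖muHat μ (n + 1)‖ ^ 2 / (1 + ((n : ℝ) + 1)) ^ (1 - α)

/-- `C_α(E) = 0`: every probability measure supported on a compact subset of `E`
has infinite `α`-energy. -/
def CapacityZero (α : ℝ) (E : Set (AddCircle (2 * Real.pi))) : Prop :=
  ∀ μ : Measure (AddCircle (2 * Real.pi)), IsProbabilityMeasure μ →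
    (∃ K, K ⊆ E ∧ IsCompact K ∧ μ Kᶜ = 0) → ¬ HasFiniteEnergy α μ

/-- `C_α(E) > 0`: some probability measure supported on a compact subset of `E`
has finite `α`-energy. -/
def CapacityPos (α : ℝ) (E : Set (AddCircle (2 * Real.pi))) : Prop :=
  ∃ μ : Measure (AddCircle (2 * Real.pi)), IsProbabilityMeasure μ ∧
    (∃ K, K ⊆ E ∧ IsCompact K ∧ μ Kᶜ = 0) ∧ HasFiniteEnergy α μ

/-- The `k`-fold Minkowski sum `k × E = E + ⋯ + E`. -/
def kFold (k : ℕ) (E : Set (AddCircle (2 * Real.pi))) : Set (AddCircle (2 * Real.pi)) :=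
  {x | ∃ g : Fin k → AddCircle (2 * Real.pi), (∀ i, g i ∈ E) ∧ x = ∑ i, g i}

/-- Smoothness (`C^∞`) of a function on the circle, via its lift to `ℝ`. -/
def SmoothOnCircle (φ : AddCircle (2 * Real.pi) → ℂ) : Prop :=
  ContDiff ℝ (⊤ : ℕ∞) fun x : ℝ => φ (↑x)

/-- `supp S ⊆ E` for the distribution `S` with Fourier coefficients `s`:
`⟨S, φ⟩ = ∑ₙ Ŝ(n) φ̂(−n) = 0` for every `C^∞` function `φ` supported in `𝕋 ∖ E`. -/
def DistSuppIn (s : ℤ → ℂ) (E : Set (AddCircle (2 * Real.pi))) : Prop :=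
  ∀ φ : AddCircle (2 * Real.pi) → ℂ, SmoothOnCircle φ → tsupport φ ⊆ Eᶜ →
    ∑' n : ℤ, s n * fourierCoeff φ (-n) = 0

/-! ### Helper material -/

abbrev TT := AddCircle (2 * Real.pi)

/-- The weight `1 + |n|`. -/
def om (n : ℤ) : ℝ≥0∞ := ENNReal.ofReal (1 + |(n : ℝ)|)

/-- The `A^1_β` norm. -/
def NA (β : ℝ) (g : C(TT, ℂ)) : ℝ≥0∞ := ∑' n : ℤ, ‖fourierCoeff g n‖ₑ * om n ^ β

/-- The `A^p_β` norm. -/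
def NP (p β : ℝ) (g : C(TT, ℂ)) : ℝ≥0∞ :=
  (∑' n : ℤ, (‖fourierCoeff g n‖ₑ * om n ^ β) ^ p) ^ (1 / p)

/-- A discrete Besov energy equivalent to the `H^s` norm squared. -/
def Q {E : Type*} [NormedAddCommGroup E] (s : ℝ) (g : TT → E) : ℝ≥0∞ :=
  (∫⁻ x, ‖g x‖ₑ ^ 2 ∂AddCircle.haarAddCircle) +
    ∑' j : ℕ, ENNReal.ofReal ((2 : ℝ) ^ (2 * s * j)) *
      ∫⁻ x, ‖g (x + (((2 : ℝ)⁻¹ ^ j : ℝ) : TT)) - g x‖ₑ ^ 2 ∂AddCircle.haarAddCircle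

lemma one_le_om (n : ℤ) : 1 ≤ om n := by
  unfold om
  rw [ENNReal.one_le_ofReal]
  linarith [abs_nonneg (n : ℝ)]

lemma om_ne_zero (n : ℤ) : om n ≠ 0 := (lt_of_lt_of_le one_pos (one_le_om n)).ne'

lemma om_ne_top (n : ℤ) : om n ≠ ⊤ := ENNReal.ofReal_ne_top

lemma om_add_le (k m : ℤ) : om (k + m) ≤ om k * om m := by
  unfold om
  rw [← ENNReal.ofReal_mul (by positivity)]
  apply ENNReal.ofReal_le_ofReal
  push_cast
  nlinarith [abs_add_le (k : ℝ) m, abs_nonneg (k : ℝ), abs_nonneg (m : ℝ),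
    mul_nonneg (abs_nonneg (k : ℝ)) (abs_nonneg (m : ℝ))]

lemma integrable_cont (g : C(TT, ℂ)) : Integrable g AddCircle.haarAddCircle :=
  g.continuous.integrable_of_hasCompactSupport (HasCompactSupport.of_compactSpace _)

lemma fc_add (g h : C(TT, ℂ)) (n : ℤ) :
    fourierCoeff (g + h : C(TT, ℂ)) n = fourierCoeff g n + fourierCoeff h n := by
  have := congrFun (fourierCoeff.add (integrable_cont g) (integrable_cont h)) n
  simpa using this

lemma fc_neg (g : C(TT, ℂ)) (n : ℤ) :
    fourierCoeff (-g : C(TT, ℂ)) n = - fourierCoeff g n := by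
  have := fourierCoeff.const_mul (g : TT → ℂ) (-1) n
  simp only [neg_one_mul] at this
  exact this

lemma fc_sub (g h : C(TT, ℂ)) (n : ℤ) :
    fourierCoeff (g - h : C(TT, ℂ)) n = fourierCoeff g n - fourierCoeff h n := by
  rw [sub_eq_add_neg, fc_add, fc_neg, sub_eq_add_neg]

lemma NA_add (β : ℝ) (g h : C(TT, ℂ)) : NA β (g + h) ≤ NA β g + NA β h := by
  unfold NA
  rw [← ENNReal.tsum_add]
  refine ENNReal.tsum_le_tsum fun n => ?_
  rw [fc_add, ← add_mul]
  gcongr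
  exact enorm_add_le _ _

lemma NP_add (p β : ℝ) (hp : 1 ≤ p) (g h : C(TT, ℂ)) :
    NP p β (g + h) ≤ NP p β g + NP p β h := by
  have H := ENNReal.lintegral_Lp_add_le (μ := (Measure.count : Measure ℤ)) (p := p)
    (f := fun n => ‖fourierCoeff g n‖ₑ * om n ^ β) (g := fun n => ‖fourierCoeff h n‖ₑ * om n ^ β)
    (by fun_prop) (by fun_prop) hp
  simp only [lintegral_count, Pi.add_apply] at H
  refine le_trans ?_ H
  unfold NP
  gcongr with n
  rw [fc_add, ← add_mul]
  gcongr
  exact enorm_add_le _ _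

lemma NP_le_NA (p β : ℝ) (hp : 1 ≤ p) (g : C(TT, ℂ)) : NP p β g ≤ NA β g := by
  have hp0 : 0 < p := by linarith
  unfold NP
  rw [one_div, ENNReal.rpow_inv_le_iff hp0]
  have h1 : ∀ n : ℤ, (‖fourierCoeff g n‖ₑ * om n ^ β) ^ p ≤
      (‖fourierCoeff g n‖ₑ * om n ^ β) * (NA β g) ^ (p - 1) := by
    intro n
    have h2 : (‖fourierCoeff g n‖ₑ * om n ^ β) ^ p =
        (‖fourierCoeff g n‖ₑ * om n ^ β) ^ (1 : ℝ) * (‖fourierCoeff g n‖ₑ * om n ^ β) ^ (p - 1) := by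
      rw [← ENNReal.rpow_add_of_nonneg _ _ (by norm_num) (by linarith)]
      congr 1; ring
    rw [h2, ENNReal.rpow_one]
    gcongr
    · exact ENNReal.le_tsum (f := fun n : ℤ => ‖fourierCoeff g n‖ₑ * om n ^ β) n
  refine (ENNReal.tsum_le_tsum h1).trans ?_
  rw [ENNReal.tsum_mul_right]
  change NA β g * NA β g ^ (p - 1) ≤ _
  conv_lhs => enter [1]; rw [← ENNReal.rpow_one (NA β g)]
  rw [← ENNReal.rpow_add_of_nonneg _ _ (by norm_num) (by linarith)]
  apply le_of_eq; congr 1; ring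

lemma NA_eq_NP (β : ℝ) (g : C(TT, ℂ)) : NA β g = NP 1 β g := by
  simp [NA, NP]

lemma normA_eq (p β : ℝ) (hp : 1 ≤ p) (g : C(TT, ℂ)) :
    normA p β (fourierCoeff g) = (NP p β g).toReal := by
  have hp0 : 0 < p := by linarith
  unfold normA NP wSum
  rw [← ENNReal.toReal_rpow, ENNReal.tsum_toReal_eq]
  · congr 2
    ext n
    rw [← ENNReal.toReal_rpow, ENNReal.toReal_mul, ← ENNReal.toReal_rpow,
      Real.mul_rpow ENNReal.toReal_nonneg (by positivity), toReal_enorm, om,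
      ENNReal.toReal_ofReal (by positivity), ← Real.rpow_mul (by positivity), mul_comm β p]
  · intro n
    apply ENNReal.rpow_ne_top_of_nonneg hp0.le
    apply ENNReal.mul_ne_top enorm_ne_top
    exact ENNReal.rpow_ne_top_of_ne_zero (om_ne_zero n) (om_ne_top n)

lemma summable_fc (β : ℝ) (hβ : 0 ≤ β) (g : C(TT, ℂ)) (hg : NA β g ≠ ⊤) :
    Summable (fourierCoeff g) := by
  apply Summable.of_norm
  have : (∑' n : ℤ, ‖fourierCoeff g n‖ₑ) ≠ ⊤ := by
    refine ne_top_of_le_ne_top hg ?_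
    unfold NA
    refine ENNReal.tsum_le_tsum fun n => ?_
    conv_lhs => rw [← mul_one ‖fourierCoeff g n‖ₑ]
    gcongr
    simpa using ENNReal.rpow_le_rpow (one_le_om n) hβ
  have h2 := ENNReal.summable_toReal this
  simpa using h2

lemma fc_fourier_mul (h : C(TT, ℂ)) (k n : ℤ) :
    fourierCoeff (fourier k * h : C(TT, ℂ)) n = fourierCoeff h (n - k) := by
  unfold fourierCoeff
  congr 1
  ext t
  have : (fourier (-(n - k)) t : ℂ) = fourier (-n) t * fourier k t := by
    rw [← fourier_add]; congr 2; ring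
  rw [this]
  simp only [ContinuousMap.mul_apply, smul_eq_mul]
  ring

lemma fc_mul (g h : C(TT, ℂ)) (hg : Summable (fourierCoeff g)) (n : ℤ) :
    fourierCoeff (g * h : C(TT, ℂ)) n = ∑' k, fourierCoeff g k * fourierCoeff h (n - k) := by
  have h1 : HasSum (fun k => fourierCoeff g k • (fourier k * h : C(TT, ℂ))) (g * h) := by
    have := (hasSum_fourier_series_of_summable hg).mul_right h
    simpa [smul_mul_assoc] using this
  have hn : Summable fun k => ‖fourierCoeff g k • (fourier k * h : C(TT, ℂ))‖ := by
    refine Summable.of_nonneg_of_le (fun _ => norm_nonneg _) (fun k => ?_)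
      (hg.norm.mul_right ‖h‖)
    rw [norm_smul]
    gcongr
    refine (norm_mul_le _ _).trans ?_
    rw [fourier_norm, one_mul]
  have hs := hasSum_integral_of_summable_integral_norm
    (μ := (AddCircle.haarAddCircle : Measure TT))
    (F := fun k t => fourier (-n) t • (fourierCoeff g k • (fourier k * h : C(TT, ℂ))) t) ?_ ?_
  · have e1 : ∀ k, ∫ t, fourier (-n) t • (fourierCoeff g k • (fourier k * h : C(TT, ℂ))) t
        ∂AddCircle.haarAddCircle = fourierCoeff g k * fourierCoeff h (n - k) := by
      intro k
      rw [← fc_fourier_mul h k n]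
      have := fourierCoeff.const_mul (fourier k * h : C(TT, ℂ)) (fourierCoeff g k) n
      rw [← this]
      simp [fourierCoeff]
    simp only [e1] at hs
    rw [hs.tsum_eq]
    unfold fourierCoeff
    congr 1
    ext t
    rw [tsum_const_smul'' ]
    congr 1
    have h3 := (ContinuousMap.evalCLM ℂ t : C(TT, ℂ) →L[ℂ] ℂ).hasSum h1
    exact h3.tsum_eq.symm
  · intro k
    exact (integrable_cont _).fourier_smul _
  · refine Summable.of_nonneg_of_le (fun _ => by positivity) (fun k => ?_) hn
    have : ∀ t, ‖fourier (-n) t • (fourierCoeff g k • (fourier k * h : C(TT, ℂ))) t‖ ≤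
        ‖fourierCoeff g k • (fourier k * h : C(TT, ℂ))‖ := by
      intro t
      rw [norm_smul]
      have h1 : ‖(fourier (-n) t : ℂ)‖ = 1 := Circle.norm_coe _
      rw [h1, one_mul]
      exact ContinuousMap.norm_coe_le_norm _ t
    refine (integral_mono_of_nonneg (Eventually.of_forall fun _ => norm_nonneg _)
      (integrable_const _) (Eventually.of_forall this)).trans ?_
    simp

lemma NA_mul (β : ℝ) (hβ : 0 ≤ β) (g h : C(TT, ℂ)) (hg : NA β g ≠ ⊤) :
    NA β (g * h) ≤ NA β g * NA β h := by
  have hs := summable_fc β hβ g hg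
  have h1 : ∀ n, ‖fourierCoeff (g * h : C(TT, ℂ)) n‖ₑ * om n ^ β ≤
      ∑' k, (‖fourierCoeff g k‖ₑ * om k ^ β) *
        (‖fourierCoeff h (n - k)‖ₑ * om (n - k) ^ β) := by
    intro n
    rw [fc_mul g h hs]
    refine (mul_le_mul_left (enorm_tsum_le_tsum_enorm) _).trans ?_
    rw [← ENNReal.tsum_mul_right]
    refine ENNReal.tsum_le_tsum fun k => ?_
    rw [enorm_mul]
    have : om n ^ β ≤ om k ^ β * om (n - k) ^ β := by
      rw [← ENNReal.mul_rpow_of_nonneg _ _ hβ]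
      gcongr
      have := om_add_le k (n - k)
      simpa using this
    calc _ ≤ ‖fourierCoeff g k‖ₑ * ‖fourierCoeff h (n - k)‖ₑ * (om k ^ β * om (n - k) ^ β) := by
          gcongr
      _ = _ := by ring
  refine (ENNReal.tsum_le_tsum h1).trans ?_
  rw [ENNReal.tsum_comm]
  unfold NA
  rw [← ENNReal.tsum_mul_right]
  refine ENNReal.tsum_le_tsum fun k => ?_
  rw [ENNReal.tsum_mul_left]
  refine mul_le_mul_right ?_ _
  exact ((Equiv.subRight k).tsum_eq (fun n => ‖fourierCoeff h n‖ₑ * om n ^ β)).le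

lemma parseval (g : C(TT, ℂ)) :
    ∑' n, ‖fourierCoeff g n‖ₑ ^ 2 = ∫⁻ x, ‖g x‖ₑ ^ 2 ∂AddCircle.haarAddCircle := by
  have h := hasSum_sq_fourierCoeff
    (ContinuousMap.toLp (E := ℂ) 2 (AddCircle.haarAddCircle : Measure TT) ℂ g)
  simp only [fourierCoeff_toLp] at h
  have hae := ContinuousMap.coeFn_toLp (E := ℂ) (p := 2)
    (AddCircle.haarAddCircle : Measure TT) (𝕜 := ℂ) g
  have e : ∫ t : TT, ‖(ContinuousMap.toLp (E := ℂ) 2 (AddCircle.haarAddCircle : Measure TT) ℂ g) t‖ ^ 2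
      ∂AddCircle.haarAddCircle = ∫ t : TT, ‖g t‖ ^ 2 ∂AddCircle.haarAddCircle := by
    apply integral_congr_ae
    filter_upwards [hae] with x hx
    rw [hx]
  rw [e] at h
  have hI : Integrable (fun t : TT => ‖g t‖ ^ 2) AddCircle.haarAddCircle :=
    (by fun_prop : Continuous fun t : TT => ‖g t‖ ^ 2).integrable_of_hasCompactSupport
      (HasCompactSupport.of_compactSpace _)
  have h2 := ofReal_integral_eq_lintegral_ofReal hI (Eventually.of_forall fun _ => by positivity)
  have h3 : ∀ z : ℂ, ENNReal.ofReal (‖z‖ ^ 2) = ‖z‖ₑ ^ 2 := by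
    intro z
    rw [ENNReal.ofReal_pow (norm_nonneg _), ofReal_norm]
  simp only [h3] at h2
  rw [← h2, ← h.tsum_eq, ENNReal.ofReal_tsum_of_nonneg (fun _ => by positivity) h.summable]
  simp only [h3]

/-- translation -/
def tr (y : TT) (g : C(TT, ℂ)) : C(TT, ℂ) := ⟨fun x => g (x + y), by fun_prop⟩

lemma fc_tr (y : TT) (g : C(TT, ℂ)) (n : ℤ) :
    fourierCoeff (tr y g) n = fourier n y * fourierCoeff g n := by
  unfold fourierCoeff
  have h := integral_add_right_eq_self (μ := (AddCircle.haarAddCircle : Measure TT))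
    (fun t => fourier (-n) (t - y) • g t) y
  simp only [add_sub_cancel_right] at h
  change ∫ t, fourier (-n) t • g (t + y) ∂_ = _
  rw [h, ← integral_const_mul]
  congr 1
  ext t
  have : (fourier (-n) (t - y) : ℂ) = fourier n y * fourier (-n) t := by
    simp only [fourier_apply, ← Circle.coe_mul, ← AddCircle.toCircle_add]
    congr 2
    simp [smul_sub]
    abel
  rw [this]
  simp only [smul_eq_mul]; ring

lemma fourier_real (n : ℤ) (x : ℝ) :
    fourier n (x : TT) = Complex.exp (((n * x : ℝ) : ℂ) * Complex.I) := by
  rw [fourier_coe_apply]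
  congr 1
  push_cast
  have : (Real.pi : ℂ) ≠ 0 := by exact_mod_cast Real.pi_ne_zero
  field_simp

lemma exp_lower (θ : ℝ) (h1 : 1 ≤ |θ|) (h2 : |θ| ≤ 2) :
    (1 : ℝ) / 2 ≤ ‖Complex.exp ((θ : ℂ) * Complex.I) - 1‖ ^ 2 := by
  have e : ‖Complex.exp ((θ : ℂ) * Complex.I) - 1‖ ^ 2 = 2 - 2 * Real.cos θ := by
    rw [Complex.sq_norm, Complex.normSq_apply]
    simp only [Complex.sub_re, Complex.exp_ofReal_mul_I_re, Complex.one_re, Complex.sub_im,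
      Complex.exp_ofReal_mul_I_im, Complex.one_im]
    nlinarith [Real.sin_sq_add_cos_sq θ]
  rw [e, ← Real.cos_abs]
  have : Real.cos |θ| ≤ Real.cos 1 :=
    Real.cos_le_cos_of_nonneg_of_le_pi (by norm_num) (by linarith [Real.pi_gt_three]) h1
  linarith [Real.cos_one_le]

lemma om_le_term (s : ℝ) (hs0 : 0 < s) (hs1 : s < 1) (n : ℤ) :
    om n ^ (2 * s) ≤ 32 * (1 + ∑' j : ℕ, ENNReal.ofReal ((2 : ℝ) ^ (2 * s * j)) *
      ‖(fourier n (((2 : ℝ)⁻¹ ^ j : ℝ) : TT) : ℂ) - 1‖ₑ ^ 2) := by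
  by_cases hn : n = 0
  · subst hn
    simp [om]
  obtain ⟨j, hj1, hj2⟩ := exists_nat_pow_near (x := |(n : ℝ)|) (y := 2)
    (by exact_mod_cast Int.one_le_abs hn) (by norm_num)
  have hp : (0 : ℝ) < 2 ^ j := by positivity
  set θ : ℝ := n * (2 : ℝ)⁻¹ ^ j with hθ
  have hθa : |θ| = |(n : ℝ)| / 2 ^ j := by
    rw [hθ, abs_mul, inv_pow, abs_inv, abs_of_pos hp]; rfl
  have h1 : 1 ≤ |θ| := by rw [hθa, le_div_iff₀ hp]; linarith
  have h2 : |θ| ≤ 2 := by rw [hθa, div_le_iff₀ hp]; rw [pow_succ] at hj2; linarith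
  have h3 := exp_lower θ h1 h2
  have key : (1 + |(n : ℝ)|) ^ (2 * s) ≤
      32 * ((2 : ℝ) ^ (2 * s * j) * ‖(fourier n (((2 : ℝ)⁻¹ ^ j : ℝ) : TT) : ℂ) - 1‖ ^ 2) := by
    rw [fourier_real]
    have h4 : 1 + |(n : ℝ)| ≤ 4 * 2 ^ j := by
      have : (1 : ℝ) ≤ 2 ^ j := one_le_pow₀ (by norm_num)
      rw [pow_succ] at hj2
      linarith [one_le_pow₀ (by norm_num : (1 : ℝ) ≤ 2) (n := j)]
    calc (1 + |(n : ℝ)|) ^ (2 * s) ≤ (4 * 2 ^ j : ℝ) ^ (2 * s) := by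
          apply Real.rpow_le_rpow (by positivity) h4 (by linarith)
      _ = (4 : ℝ) ^ (2 * s) * (2 : ℝ) ^ (2 * s * j) := by
          rw [Real.mul_rpow (by norm_num) (by positivity), ← Real.rpow_natCast,
            ← Real.rpow_mul (by norm_num)]
          congr 2; ring
      _ ≤ 16 * (2 : ℝ) ^ (2 * s * j) := by
          gcongr
          calc (4 : ℝ) ^ (2 * s) ≤ (4 : ℝ) ^ (2 : ℝ) :=
                Real.rpow_le_rpow_of_exponent_le (by norm_num) (by linarith)
            _ = 16 := by norm_num
      _ = 32 * ((2 : ℝ) ^ (2 * s * j) * (1 / 2)) := by ring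
      _ ≤ _ := by gcongr
  have hen : ENNReal.ofReal ((2 : ℝ) ^ (2 * s * j)) *
      ‖(fourier n (((2 : ℝ)⁻¹ ^ j : ℝ) : TT) : ℂ) - 1‖ₑ ^ 2 = ENNReal.ofReal
      ((2 : ℝ) ^ (2 * s * j) * ‖(fourier n (((2 : ℝ)⁻¹ ^ j : ℝ) : TT) : ℂ) - 1‖ ^ 2) := by
    rw [ENNReal.ofReal_mul (by positivity), ENNReal.ofReal_pow (norm_nonneg _), ofReal_norm]
  calc om n ^ (2 * s) = ENNReal.ofReal ((1 + |(n : ℝ)|) ^ (2 * s)) := by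
        rw [om, ENNReal.ofReal_rpow_of_nonneg (by positivity) (by linarith)]
    _ ≤ ENNReal.ofReal (32 * ((2 : ℝ) ^ (2 * s * j) *
          ‖(fourier n (((2 : ℝ)⁻¹ ^ j : ℝ) : TT) : ℂ) - 1‖ ^ 2)) := ENNReal.ofReal_le_ofReal key
    _ = 32 * (ENNReal.ofReal ((2 : ℝ) ^ (2 * s * j)) *
      ‖(fourier n (((2 : ℝ)⁻¹ ^ j : ℝ) : TT) : ℂ) - 1‖ₑ ^ 2) := by
        rw [ENNReal.ofReal_mul (by norm_num), hen]; norm_num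
    _ ≤ _ := by
        gcongr
        refine le_trans ?_ le_add_self
        exact ENNReal.le_tsum (f := fun j : ℕ => ENNReal.ofReal ((2 : ℝ) ^ (2 * s * j)) *
          ‖(fourier n (((2 : ℝ)⁻¹ ^ j : ℝ) : TT) : ℂ) - 1‖ₑ ^ 2) j

lemma sobolev_le_Q (s : ℝ) (hs0 : 0 < s) (hs1 : s < 1) (g : C(TT, ℂ)) :
    ∑' n, ‖fourierCoeff g n‖ₑ ^ 2 * om n ^ (2 * s) ≤ 32 * Q s g := by
  have hQ : Q s g = ∑' n, ‖fourierCoeff g n‖ₑ ^ 2 *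
      (1 + ∑' j : ℕ, ENNReal.ofReal ((2 : ℝ) ^ (2 * s * j)) *
      ‖(fourier n (((2 : ℝ)⁻¹ ^ j : ℝ) : TT) : ℂ) - 1‖ₑ ^ 2) := by
    simp only [mul_add, mul_one]
    rw [ENNReal.tsum_add, Q, parseval]
    congr 1
    simp only [← ENNReal.tsum_mul_left]
    rw [ENNReal.tsum_comm]
    congr 1
    ext j
    have := parseval (tr (((2 : ℝ)⁻¹ ^ j : ℝ) : TT) g - g)
    simp only [fc_sub, fc_tr] at this
    change _ * ∫⁻ x, ‖(tr (((2 : ℝ)⁻¹ ^ j : ℝ) : TT) g - g) x‖ₑ ^ 2 ∂_ = _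
    rw [← this, ← ENNReal.tsum_mul_left]
    congr 1
    ext n
    have e : ∀ a b : ℂ, a * b - b = b * (a - 1) := fun a b => by ring
    rw [e, enorm_mul]
    ring
  rw [hQ, ← ENNReal.tsum_mul_left]
  refine ENNReal.tsum_le_tsum fun n => ?_
  calc _ ≤ ‖fourierCoeff g n‖ₑ ^ 2 * (32 * (1 + ∑' j : ℕ, ENNReal.ofReal ((2 : ℝ) ^ (2 * s * j)) *
      ‖(fourier n (((2 : ℝ)⁻¹ ^ j : ℝ) : TT) : ℂ) - 1‖ₑ ^ 2)) := by
        gcongr; exact om_le_term s hs0 hs1 n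
    _ = _ := by ring

lemma om_sum_ne_top (r : ℝ) (hr : r < -1) : ∑' n : ℤ, om n ^ r ≠ ⊤ := by
  have hs : Summable fun n : ℤ => (1 + |(n : ℝ)|) ^ r := by
    have hN : Summable fun n : ℕ => (1 + (n : ℝ)) ^ r := by
      have := (summable_nat_add_iff 1).2 (Real.summable_nat_rpow.2 hr)
      refine this.congr fun n => ?_
      push_cast; rw [add_comm]
    apply Summable.of_nat_of_neg
    · refine hN.congr fun n => ?_
      simp
    · refine hN.congr fun n => ?_
      simp
  have e : ∀ n : ℤ, om n ^ r = ENNReal.ofReal ((1 + |(n : ℝ)|) ^ r) := by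
    intro n
    rw [om, ENNReal.ofReal_rpow_of_pos (by positivity)]
  simp only [e]
  exact hs.tsum_ofReal_ne_top

lemma NP_le_Q (p β s : ℝ) (hp1 : 1 ≤ p) (hp2 : p < 2) (hs0 : 0 < s) (hs1 : s < 1)
    (h : 1 / p - 1 / 2 < s - β) :
    ∃ K : ℝ≥0∞, K ≠ ⊤ ∧ ∀ g : C(TT, ℂ), NP p β g ≤ K * (Q s g) ^ (1 / 2 : ℝ) := by
  have hp0 : 0 < p := by linarith
  have h2p : 0 < 2 - p := by linarith
  have hconj : (2 / p).HolderConjugate (2 / (2 - p)) := by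
    rw [Real.holderConjugate_iff]
    constructor
    · rw [lt_div_iff₀ hp0]; linarith
    · field_simp; ring
  set W : ℝ≥0∞ := ∑' n : ℤ, om n ^ (p * (β - s) * (2 / (2 - p))) with hW
  have hWt : W ≠ ⊤ := by
    apply om_sum_ne_top
    have h3 : (2 - p) / (2 * p) < s - β := by
      have : (2 - p) / (2 * p) = 1 / p - 1 / 2 := by field_simp
      rw [this]; exact h
    rw [div_lt_iff₀ (by positivity)] at h3
    rw [mul_div_assoc', div_lt_iff₀ h2p]
    nlinarith
  refine ⟨(32 : ℝ≥0∞) ^ (1 / 2 : ℝ) * (W ^ (1 / (2 / (2 - p)))) ^ (1 / p), ?_, fun g => ?_⟩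
  · apply ENNReal.mul_ne_top
    · exact ENNReal.rpow_ne_top_of_nonneg (by norm_num) (by norm_num)
    · exact ENNReal.rpow_ne_top_of_nonneg (by positivity)
        (ENNReal.rpow_ne_top_of_nonneg (by positivity) hWt)
  have H := ENNReal.lintegral_mul_le_Lp_mul_Lq (Measure.count : Measure ℤ) hconj
    (f := fun n => (‖fourierCoeff g n‖ₑ * om n ^ s) ^ p) (g := fun n => om n ^ (p * (β - s)))
    (by fun_prop) (by fun_prop)
  simp only [lintegral_count, Pi.mul_apply] at H
  have e1 : ∀ n, (‖fourierCoeff g n‖ₑ * om n ^ s) ^ p * om n ^ (p * (β - s)) =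
      (‖fourierCoeff g n‖ₑ * om n ^ β) ^ p := by
    intro n
    rw [ENNReal.mul_rpow_of_nonneg _ _ hp0.le, ENNReal.mul_rpow_of_nonneg _ _ hp0.le, mul_assoc,
      ← ENNReal.rpow_mul, ← ENNReal.rpow_mul, ← ENNReal.rpow_add _ _ (om_ne_zero n) (om_ne_top n)]
    congr 2; ring
  have e2 : ∀ n, ((‖fourierCoeff g n‖ₑ * om n ^ s) ^ p) ^ (2 / p) =
      ‖fourierCoeff g n‖ₑ ^ 2 * om n ^ (2 * s) := by
    intro n
    rw [← ENNReal.rpow_mul, mul_div_cancel₀ _ hp0.ne', ENNReal.mul_rpow_of_nonneg _ _ (by norm_num),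
      ← ENNReal.rpow_mul, mul_comm s 2, ENNReal.rpow_two]
  have e3 : ∀ n : ℤ, (om n ^ (p * (β - s))) ^ (2 / (2 - p)) =
      om n ^ (p * (β - s) * (2 / (2 - p))) := fun n => by rw [← ENNReal.rpow_mul]
  simp only [e1, e2, e3] at H
  unfold NP
  calc _ ≤ ((∑' n, ‖fourierCoeff g n‖ₑ ^ 2 * om n ^ (2 * s)) ^ (1 / (2 / p)) *
        W ^ (1 / (2 / (2 - p)))) ^ (1 / p) := by gcongr
    _ ≤ ((32 * Q s g) ^ (1 / (2 / p)) * W ^ (1 / (2 / (2 - p)))) ^ (1 / p) := by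
        gcongr; exact sobolev_le_Q s hs0 hs1 g
    _ = (32 * Q s g) ^ (1 / 2 : ℝ) * (W ^ (1 / (2 / (2 - p)))) ^ (1 / p) := by
        rw [ENNReal.mul_rpow_of_nonneg _ _ (by positivity), ← ENNReal.rpow_mul]
        congr 2; field_simp
    _ = _ := by
        rw [ENNReal.mul_rpow_of_nonneg _ _ (by norm_num)]; ring

lemma norm_coe_le_abs (h : ℝ) : ‖(h : TT)‖ ≤ |h| := by
  rw [AddCircle.norm_eq]
  have hp : (0 : ℝ) < 2 * Real.pi := by positivity
  have h1 := round_le ((2 * Real.pi)⁻¹ * h) 0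
  have e1 : h - round ((2 * Real.pi)⁻¹ * h) * (2 * Real.pi) =
      (2 * Real.pi) * ((2 * Real.pi)⁻¹ * h - round ((2 * Real.pi)⁻¹ * h)) := by
    field_simp
  have e2 : |h| = (2 * Real.pi) * |(2 * Real.pi)⁻¹ * h - (0 : ℤ)| := by
    rw [Int.cast_zero, sub_zero, abs_mul, abs_inv, abs_of_pos hp]; field_simp
  rw [e1, e2, abs_mul, abs_of_pos hp]
  gcongr

lemma dist_add_coe (x : TT) (h : ℝ) : dist (x + (h : TT)) x ≤ |h| := by
  rw [dist_eq_norm, add_sub_cancel_left]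
  exact norm_coe_le_abs h

lemma enorm_sq_le {E : Type*} [NormedAddCommGroup E] (z : E) (a : ℝ) (h : ‖z‖ ≤ a) :
    ‖z‖ₑ ^ 2 ≤ ENNReal.ofReal (a ^ 2) := by
  rw [ENNReal.ofReal_pow ((norm_nonneg z).trans h), ← ofReal_norm]
  gcongr

lemma two_pow_split (s : ℝ) (j : ℕ) :
    (2 : ℝ) ^ (2 * s * j) * ((2 : ℝ)⁻¹ ^ j) ^ 2 = ((2 : ℝ) ^ (2 * s - 2)) ^ j := by
  rw [← Real.rpow_natCast, ← Real.rpow_natCast, ← Real.rpow_natCast, ← Real.rpow_mul (by norm_num),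
    ← Real.rpow_mul (by norm_num), Real.inv_rpow (by norm_num), ← Real.rpow_neg (by norm_num),
    ← Real.rpow_add (by norm_num)]
  congr 1; push_cast; ring

lemma Q_lip (s : ℝ) (hs1 : s < 1) :
    ∃ K : ℝ≥0∞, K ≠ ⊤ ∧ ∀ (g : C(TT, ℂ)) (M L : ℝ), 0 ≤ M → 0 ≤ L → (∀ x, ‖g x‖ ≤ M) →
      (∀ x y, ‖g x - g y‖ ≤ L * dist x y) → Q s g ≤ K * ENNReal.ofReal ((M + L) ^ 2) := by
  have hr : (2 : ℝ) ^ (2 * s - 2) < 1 := Real.rpow_lt_one_of_one_lt_of_neg (by norm_num) (by linarith)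
  have hsum := (summable_geometric_of_lt_one (by positivity) hr).tsum_ofReal_ne_top
  refine ⟨1 + ∑' j : ℕ, ENNReal.ofReal (((2 : ℝ) ^ (2 * s - 2)) ^ j), by finiteness,
    fun g M L hM hL h1 h2 => ?_⟩
  unfold Q
  rw [add_mul, one_mul]
  gcongr
  · calc _ ≤ ∫⁻ x : TT, ENNReal.ofReal ((M + L) ^ 2) ∂AddCircle.haarAddCircle := by
          apply lintegral_mono
          intro x
          exact enorm_sq_le _ _ ((h1 x).trans (by linarith))
      _ = _ := by simp
  · rw [← ENNReal.tsum_mul_right]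
    refine ENNReal.tsum_le_tsum fun j => ?_
    calc _ ≤ ENNReal.ofReal ((2 : ℝ) ^ (2 * s * j)) * ∫⁻ x : TT,
          ENNReal.ofReal (((M + L) * (2 : ℝ)⁻¹ ^ j) ^ 2) ∂AddCircle.haarAddCircle := by
          gcongr with x
          apply enorm_sq_le
          refine (h2 _ _).trans ?_
          have := dist_add_coe x ((2 : ℝ)⁻¹ ^ j)
          rw [abs_of_pos (by positivity)] at this
          gcongr
          linarith
      _ = _ := by
          simp only [lintegral_const, measure_univ, mul_one]
          rw [← ENNReal.ofReal_mul (by positivity), ← ENNReal.ofReal_mul (by positivity),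
            ← two_pow_split]
          congr 1; ring

lemma haar_ball (x : TT) (r : ℝ) (hr : 0 ≤ r) :
    (AddCircle.haarAddCircle : Measure TT) (Metric.closedBall x r) ≤ ENNReal.ofReal r := by
  have h := AddCircle.volume_closedBall (T := 2 * Real.pi) (x := x) r
  rw [AddCircle.volume_eq_smul_haarAddCircle] at h
  simp only [Measure.smul_apply, smul_eq_mul] at h
  have hp : (0 : ℝ) < 2 * Real.pi := by positivity
  have h2 : ENNReal.ofReal (2 * Real.pi) * (AddCircle.haarAddCircle : Measure TT)
      (Metric.closedBall x r) ≤ ENNReal.ofReal (2 * Real.pi) * ENNReal.ofReal r := by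
    rw [h, ← ENNReal.ofReal_mul hp.le]
    apply ENNReal.ofReal_le_ofReal
    refine (min_le_right _ _).trans ?_
    nlinarith [Real.pi_gt_three]
  rwa [ENNReal.mul_le_mul_iff_right (by simpa using Real.pi_pos) ENNReal.ofReal_ne_top] at h2

/-- bump function -/
def bm (x0 : TT) (r : ℝ) (x : TT) : ℝ := max 0 (min 1 (2 - dist x x0 / r))

lemma bm_nonneg (x0 : TT) (r : ℝ) (x : TT) : 0 ≤ bm x0 r x := le_max_left _ _

lemma bm_le_one (x0 : TT) (r : ℝ) (x : TT) : bm x0 r x ≤ 1 :=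
  max_le (by norm_num) (min_le_left _ _)

lemma bm_eq_one (x0 : TT) (r : ℝ) (hr : 0 < r) (x : TT) (h : dist x x0 ≤ r) : bm x0 r x = 1 := by
  have : dist x x0 / r ≤ 1 := by rw [div_le_one hr]; exact h
  unfold bm
  rw [min_eq_left (by linarith)]; norm_num

lemma bm_eq_zero (x0 : TT) (r : ℝ) (hr : 0 < r) (x : TT) (h : 2 * r < dist x x0) :
    bm x0 r x = 0 := by
  have : 2 ≤ dist x x0 / r := by rw [le_div_iff₀ hr]; exact h.le
  unfold bm
  rw [max_eq_left]
  exact (min_le_right _ _).trans (by linarith)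

lemma bm_lip (x0 : TT) (r : ℝ) (hr : 0 < r) (x y : TT) :
    |bm x0 r x - bm x0 r y| ≤ r⁻¹ * dist x y := by
  unfold bm
  refine (abs_max_sub_max_le_max _ _ _ _).trans ?_
  rw [sub_self, abs_zero, max_eq_right (abs_nonneg _)]
  refine (abs_min_sub_min_le_max _ _ _ _).trans ?_
  rw [sub_self, abs_zero, max_eq_right (abs_nonneg _)]
  have : 2 - dist x x0 / r - (2 - dist y x0 / r) = r⁻¹ * (dist y x0 - dist x x0) := by
    field_simp; ring
  rw [this, abs_mul, abs_of_pos (inv_pos.2 hr)]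
  gcongr
  have := abs_dist_sub_le y x x0
  rwa [dist_comm x y]

lemma bm_diff_integral (x0 : TT) (r : ℝ) (hr : 0 < r) (h : ℝ) :
    ∫⁻ x, ‖bm x0 r (x + (h : TT)) - bm x0 r x‖ₑ ^ 2 ∂AddCircle.haarAddCircle ≤
      ENNReal.ofReal ((min 1 (|h| / r)) ^ 2) * ENNReal.ofReal (4 * r) := by
  set A : Set TT := Metric.closedBall x0 (2 * r) ∪ Metric.closedBall (x0 - (h : TT)) (2 * r) with hA
  have hAm : MeasurableSet A := Metric.isClosed_closedBall.measurableSet.union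
    Metric.isClosed_closedBall.measurableSet
  calc _ ≤ ∫⁻ x, A.indicator (fun _ => ENNReal.ofReal ((min 1 (|h| / r)) ^ 2)) x
        ∂AddCircle.haarAddCircle := by
        apply lintegral_mono
        intro x
        by_cases hx : x ∈ A
        · rw [indicator_of_mem hx]
          apply enorm_sq_le
          rw [Real.norm_eq_abs]
          apply le_min
          · rw [abs_le]
            constructor <;> linarith [bm_nonneg x0 r x, bm_nonneg x0 r (x + (h : TT)),
              bm_le_one x0 r x, bm_le_one x0 r (x + (h : TT))]
          · refine (bm_lip x0 r hr _ _).trans ?_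
            rw [div_eq_inv_mul]
            gcongr
            exact dist_add_coe x h
        · rw [indicator_of_notMem hx]
          simp only [hA, mem_union, Metric.mem_closedBall, not_or, not_le] at hx
          beta_reduce
          rw [bm_eq_zero x0 r hr x hx.1, bm_eq_zero x0 r hr (x + (h : TT))]
          · simp
          · have : dist x (x0 - (h : TT)) = dist (x + (h : TT)) x0 := by
              rw [dist_eq_norm, dist_eq_norm]; congr 1; abel
            rw [← this]; exact hx.2
    _ = ENNReal.ofReal ((min 1 (|h| / r)) ^ 2) * AddCircle.haarAddCircle A := by
        rw [lintegral_indicator hAm, setLIntegral_const]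
    _ ≤ _ := by
        gcongr
        refine (measure_union_le _ _).trans ?_
        have : ENNReal.ofReal (4 * r) = ENNReal.ofReal (2 * r) + ENNReal.ofReal (2 * r) := by
          rw [← ENNReal.ofReal_add (by positivity) (by positivity)]; congr 1; ring
        rw [this]
        gcongr <;> exact haar_ball _ _ (by positivity)

lemma bm_integral (x0 : TT) (r : ℝ) (hr : 0 < r) :
    ∫⁻ x, ‖bm x0 r x‖ₑ ^ 2 ∂AddCircle.haarAddCircle ≤ ENNReal.ofReal (2 * r) := by
  set A : Set TT := Metric.closedBall x0 (2 * r) with hA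
  have hAm : MeasurableSet A := Metric.isClosed_closedBall.measurableSet
  calc _ ≤ ∫⁻ x, A.indicator (fun _ => (1 : ℝ≥0∞)) x ∂AddCircle.haarAddCircle := by
        apply lintegral_mono
        intro x
        by_cases hx : x ∈ A
        · rw [indicator_of_mem hx]
          have := enorm_sq_le (bm x0 r x) 1
            (by rw [Real.norm_eq_abs, abs_of_nonneg (bm_nonneg _ _ _)]; exact bm_le_one _ _ _)
          simpa using this
        · rw [indicator_of_notMem hx]
          simp only [hA, Metric.mem_closedBall, not_le] at hx
          beta_reduce
          rw [bm_eq_zero x0 r hr x hx]; simp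
    _ = AddCircle.haarAddCircle A := by
        rw [lintegral_indicator hAm, setLIntegral_const, one_mul]
    _ ≤ _ := haar_ball _ _ (by positivity)

lemma Z_sum (s : ℝ) (hs0 : 0 < s) (hs1 : s < 1) :
    ∑' i : ℤ, ENNReal.ofReal ((2 : ℝ) ^ (2 * s * i) * (min 1 ((2 : ℝ) ^ (-i))) ^ 2) ≠ ⊤ := by
  apply Summable.tsum_ofReal_ne_top
  apply Summable.of_nat_of_neg
  · have hr : (2 : ℝ) ^ (2 * s - 2) < 1 :=
      Real.rpow_lt_one_of_one_lt_of_neg (by norm_num) (by linarith)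
    refine Summable.of_nonneg_of_le (fun _ => by positivity) (fun j => ?_)
      (summable_geometric_of_lt_one (by positivity) hr)
    rw [← two_pow_split]
    push_cast
    gcongr
    refine (min_le_right _ _).trans ?_
    simp
  · have hr : (2 : ℝ) ^ (-(2 * s)) < 1 :=
      Real.rpow_lt_one_of_one_lt_of_neg (by norm_num) (by linarith)
    refine Summable.of_nonneg_of_le (fun _ => by positivity) (fun j => ?_)
      (summable_geometric_of_lt_one (by positivity) hr)
    rw [← Real.rpow_natCast (_ ^ _) j, ← Real.rpow_mul (by norm_num)]
    push_cast
    have h1 : (min 1 ((2 : ℝ) ^ (-(-(j : ℤ))))) ^ 2 ≤ 1 := by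
      apply pow_le_one₀ (by positivity) (min_le_left _ _)
    calc _ ≤ (2 : ℝ) ^ (2 * s * -(j : ℝ)) * 1 := by gcongr
      _ = _ := by rw [mul_one]; congr 1; ring

lemma Q_bm (s : ℝ) (hs0 : 0 < s) (hs1 : s < 1) :
    ∃ K : ℝ≥0∞, K ≠ ⊤ ∧ ∀ (x0 : TT) (m : ℕ),
      Q s (bm x0 ((2 : ℝ)⁻¹ ^ m)) ≤ K * ENNReal.ofReal (((2 : ℝ)⁻¹ ^ m) ^ (1 - 2 * s)) := by
  refine ⟨2 + (∑' i : ℤ, ENNReal.ofReal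
    ((2 : ℝ) ^ (2 * s * i) * (min 1 ((2 : ℝ) ^ (-i))) ^ 2)) * 4, ?_, fun x0 m => ?_⟩
  · have := Z_sum s hs0 hs1
    finiteness
  have hr : (0 : ℝ) < 2⁻¹ ^ m := by positivity
  have hr1 : (2 : ℝ)⁻¹ ^ m ≤ 1 := pow_le_one₀ (by norm_num) (by norm_num)
  unfold Q
  rw [add_mul]
  gcongr
  · refine (bm_integral x0 _ hr).trans ?_
    rw [ENNReal.ofReal_mul (by norm_num)]
    rw [ENNReal.ofReal_ofNat]
    gcongr
    calc (2 : ℝ)⁻¹ ^ m = ((2 : ℝ)⁻¹ ^ m) ^ (1 : ℝ) := (Real.rpow_one _).symm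
      _ ≤ _ := Real.rpow_le_rpow_of_exponent_ge hr hr1 (by linarith)
  · calc _ ≤ ∑' j : ℕ, ENNReal.ofReal ((2 : ℝ) ^ (2 * s * ((j - m : ℤ) : ℝ)) *
          (min 1 ((2 : ℝ) ^ (-(j - m : ℤ)))) ^ 2) *
            (4 * ENNReal.ofReal (((2 : ℝ)⁻¹ ^ m) ^ (1 - 2 * s))) := by
          refine ENNReal.tsum_le_tsum fun j => ?_
          refine (mul_le_mul_right (bm_diff_integral x0 _ hr ((2 : ℝ)⁻¹ ^ j)) _).trans ?_
          have h4 : (4 : ℝ≥0∞) = ENNReal.ofReal 4 := by norm_num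
          rw [h4, ← ENNReal.ofReal_mul (by positivity), ← ENNReal.ofReal_mul (by positivity),
            ← ENNReal.ofReal_mul (by positivity), ← ENNReal.ofReal_mul (by positivity)]
          apply ENNReal.ofReal_le_ofReal
          apply le_of_eq
          have e1 : |(2 : ℝ)⁻¹ ^ j| / 2⁻¹ ^ m = (2 : ℝ) ^ (-(j - m : ℤ)) := by
            rw [abs_of_pos (by positivity), neg_sub, zpow_sub₀ (by norm_num)]
            simp [div_eq_mul_inv, mul_comm]
          have e2 : (2 : ℝ) ^ (2 * s * j) * (2 : ℝ)⁻¹ ^ m =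
              (2 : ℝ) ^ (2 * s * ((j - m : ℤ) : ℝ)) * ((2 : ℝ)⁻¹ ^ m) ^ (1 - 2 * s) := by
            rw [← Real.rpow_natCast, Real.inv_rpow (by norm_num), ← Real.rpow_neg (by norm_num),
              ← Real.rpow_mul (by norm_num), ← Real.rpow_add (by norm_num),
              ← Real.rpow_add (by norm_num)]
            congr 1; push_cast; ring
          rw [e1]
          linear_combination (4 * (min 1 ((2 : ℝ) ^ (-(j - m : ℤ)))) ^ 2) * e2
      _ ≤ _ := by
          rw [ENNReal.tsum_mul_right, mul_assoc]
          gcongr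
          exact ENNReal.tsum_comp_le_tsum_of_injective
            (f := fun j : ℕ => (j - m : ℤ)) (fun a b h => by simpa using h)
            (fun i : ℤ => ENNReal.ofReal ((2 : ℝ) ^ (2 * s * i) * (min 1 ((2 : ℝ) ^ (-i))) ^ 2))

lemma enorm_sq_max (a b z : ℝ) (h : |z| ≤ max |a| |b|) : ‖z‖ₑ ^ 2 ≤ ‖a‖ₑ ^ 2 + ‖b‖ₑ ^ 2 := by
  have h1 : ∀ t : ℝ, ‖t‖ₑ ^ 2 = ENNReal.ofReal (t ^ 2) := by
    intro t
    rw [← ofReal_norm, ← ENNReal.ofReal_pow (norm_nonneg _), Real.norm_eq_abs, sq_abs]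
  rw [h1, h1, h1, ← ENNReal.ofReal_add (by positivity) (by positivity)]
  apply ENNReal.ofReal_le_ofReal
  rcases le_max_iff.1 h with h | h
  · have := sq_le_sq.2 h; nlinarith
  · have := sq_le_sq.2 h; nlinarith

lemma Q_max (s : ℝ) (u v : TT → ℝ) (hu : Continuous u) :
    Q s (fun x => max (u x) (v x)) ≤ Q s u + Q s v := by
  unfold Q
  rw [add_add_add_comm, ← ENNReal.tsum_add]
  gcongr with j
  · rw [← lintegral_add_left (by fun_prop)]
    gcongr with x
    apply enorm_sq_max
    exact abs_max_le_max_abs_abs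
  · rw [← mul_add, ← lintegral_add_left (by fun_prop)]
    gcongr with x
    apply enorm_sq_max
    exact abs_max_sub_max_le_max _ _ _ _

lemma radius_choice (d : ℝ≥0∞) (hd : d ≤ ENNReal.ofReal (1 / 2)) (α : ℝ) (h0 : 0 < α) (h1 : α < 1)
    (η : ℝ≥0∞) (hη : η ≠ 0) :
    ∃ m : ℕ, d < ENNReal.ofReal ((2 : ℝ)⁻¹ ^ m) ∧
      ENNReal.ofReal (((2 : ℝ)⁻¹ ^ m) ^ α) ≤ 4 * d ^ α + η := by
  by_cases hd0 : d = 0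
  · subst hd0
    have ht : Tendsto (fun m : ℕ => ENNReal.ofReal (((2 : ℝ)⁻¹ ^ m) ^ α)) atTop (𝓝 0) := by
      have h2 : Tendsto (fun m : ℕ => ((2 : ℝ)⁻¹ ^ α) ^ m) atTop (𝓝 0) :=
        tendsto_pow_atTop_nhds_zero_of_lt_one (by positivity)
          (Real.rpow_lt_one (by norm_num) (by norm_num) h0)
      have h3 := ENNReal.tendsto_ofReal h2
      rw [ENNReal.ofReal_zero] at h3
      refine h3.congr fun m => ?_
      congr 1
      rw [← Real.rpow_natCast, ← Real.rpow_natCast, ← Real.rpow_mul (by norm_num),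
        ← Real.rpow_mul (by norm_num), mul_comm]
    obtain ⟨m, hm⟩ := (ht.eventually (gt_mem_nhds (pos_iff_ne_zero.2 hη))).exists
    refine ⟨m, by simp, hm.le.trans le_add_self⟩
  · have hdt : d ≠ ⊤ := ne_top_of_le_ne_top ENNReal.ofReal_ne_top hd
    obtain ⟨x, hx, rfl⟩ : ∃ x : ℝ, 0 < x ∧ d = ENNReal.ofReal x :=
      ⟨d.toReal, ENNReal.toReal_pos hd0 hdt, (ENNReal.ofReal_toReal hdt).symm⟩
    rw [ENNReal.ofReal_le_ofReal_iff (by norm_num)] at hd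
    obtain ⟨n, hn1, hn2⟩ := exists_nat_pow_near_of_lt_one (x := 2 * x) (y := (2 : ℝ)⁻¹)
      (by linarith) (by linarith) (by norm_num) (by norm_num)
    refine ⟨n, ?_, ?_⟩
    · rw [ENNReal.ofReal_lt_ofReal_iff (by positivity)]; linarith
    · refine le_trans ?_ le_self_add
      have h4 : (4 : ℝ≥0∞) = ENNReal.ofReal 4 := by norm_num
      rw [h4, ENNReal.ofReal_rpow_of_pos hx, ← ENNReal.ofReal_mul (by norm_num)]
      apply ENNReal.ofReal_le_ofReal
      have h5 : (2 : ℝ)⁻¹ ^ n ≤ 4 * x := by rw [pow_succ] at hn1; linarith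
      calc _ ≤ (4 * x) ^ α := Real.rpow_le_rpow (by positivity) h5 h0.le
        _ = 4 ^ α * x ^ α := Real.mul_rpow (by norm_num) hx.le
        _ ≤ 4 * x ^ α := by
          gcongr
          calc (4 : ℝ) ^ α ≤ 4 ^ (1 : ℝ) :=
                Real.rpow_le_rpow_of_exponent_le (by norm_num) h1.le
            _ = 4 := by norm_num

lemma continuous_of_lip {E : Type*} [NormedAddCommGroup E] (u : TT → E) (L : ℝ) (hL : 0 ≤ L)
    (h : ∀ x y, ‖u x - u y‖ ≤ L * dist x y) : Continuous u := by
  have : LipschitzWith ⟨L, hL⟩ u := LipschitzWith.of_dist_le_mul fun x y => by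
    rw [dist_eq_norm]; exact h x y
  exact this.continuous

lemma finite_bump (s : ℝ) (K : ℝ≥0∞)
    (hK : ∀ (x0 : TT) (m : ℕ),
      Q s (bm x0 ((2 : ℝ)⁻¹ ^ m)) ≤ K * ENNReal.ofReal (((2 : ℝ)⁻¹ ^ m) ^ (1 - 2 * s)))
    (x : ℕ → TT) (m : ℕ → ℕ) (S : Finset ℕ) :
    ∃ (u : TT → ℝ) (L : ℝ), 0 ≤ L ∧ (∀ y z, ‖u y - u z‖ ≤ L * dist y z) ∧ (∀ y, 0 ≤ u y) ∧
      (∀ y, u y ≤ 1) ∧ (∀ i ∈ S, ∀ y ∈ Metric.ball (x i) ((2 : ℝ)⁻¹ ^ m i), u y = 1) ∧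
      Q s u ≤ ∑ i ∈ S, K * ENNReal.ofReal (((2 : ℝ)⁻¹ ^ m i) ^ (1 - 2 * s)) := by
  induction S using Finset.induction_on with
  | empty =>
    refine ⟨fun _ => 0, 0, le_rfl, by simp, by simp, by simp, by simp, ?_⟩
    simp [Q]
  | insert a S ha ih =>
    obtain ⟨u, L, hL, h1, h2, h3, h4, h5⟩ := ih
    have hr : (0 : ℝ) < 2⁻¹ ^ m a := by positivity
    refine ⟨fun y => max (u y) (bm (x a) ((2 : ℝ)⁻¹ ^ m a) y), max L ((2 : ℝ)⁻¹ ^ m a)⁻¹,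
      hL.trans (le_max_left _ _), ?_, ?_, ?_, ?_, ?_⟩
    · intro y z
      refine (abs_max_sub_max_le_max _ _ _ _).trans ?_
      apply max_le
      · refine (h1 y z).trans ?_
        gcongr
        exact le_max_left _ _
      · refine (bm_lip _ _ hr y z).trans ?_
        gcongr
        exact le_max_right _ _
    · intro y; exact (h2 y).trans (le_max_left _ _)
    · intro y; exact max_le (h3 y) (bm_le_one _ _ _)
    · intro i hi y hy
      rcases Finset.mem_insert.1 hi with rfl | hi
      · beta_reduce
        rw [bm_eq_one _ _ hr _ (Metric.mem_ball.1 hy).le]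
        exact max_eq_right (h3 y)
      · beta_reduce
        rw [h4 i hi y hy]
        exact max_eq_left (bm_le_one _ _ _)
    · rw [Finset.sum_insert ha, add_comm]
      refine (Q_max s u _ (continuous_of_lip u L hL h1)).trans ?_
      gcongr
      exact hK _ _

lemma small_bump (α : ℝ) (h0 : 0 < α) (h1 : α < 1) (E : Set TT) (hE : IsCompact E)
    (hμ : MeasureTheory.Measure.hausdorffMeasure α E = 0) (ε : ℝ≥0∞) (hε : ε ≠ 0) :
    ∃ (u : TT → ℝ) (L : ℝ) (U : Set TT), 0 ≤ L ∧ (∀ y z, ‖u y - u z‖ ≤ L * dist y z) ∧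
      (∀ y, 0 ≤ u y) ∧ (∀ y, u y ≤ 1) ∧ IsOpen U ∧ E ⊆ U ∧ (∀ y ∈ U, u y = 1) ∧
      Q ((1 - α) / 2) u ≤ ε := by
  obtain ⟨K, hKt, hK⟩ := Q_bm ((1 - α) / 2) (by linarith) (by linarith)
  -- choose small parameters
  obtain ⟨δ, hδ0, hδ⟩ : ∃ δ : ℝ≥0∞, δ ≠ 0 ∧ K * (4 * δ + δ) ≤ ε := by
    have ht : Tendsto (fun δ : ℝ≥0∞ => K * (4 * δ + δ)) (𝓝 0) (𝓝 (K * (4 * 0 + 0))) := by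
      apply ENNReal.Tendsto.const_mul _ (Or.inr hKt)
      exact (ENNReal.Tendsto.const_mul tendsto_id (Or.inr (by norm_num))).add tendsto_id
    simp only [mul_zero, add_zero] at ht
    have h2 := ht.eventually (gt_mem_nhds (pos_iff_ne_zero.2 hε))
    have h3 : ∀ᶠ δ in 𝓝[>] (0 : ℝ≥0∞), K * (4 * δ + δ) < ε := h2.filter_mono nhdsWithin_le_nhds
    obtain ⟨δ, hδ, hδ2⟩ := (h3.and self_mem_nhdsWithin).exists
    exact ⟨δ, (ne_of_gt hδ2), hδ.le⟩
  rw [Measure.hausdorffMeasure_apply] at hμ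
  simp only [ENNReal.iSup_eq_zero] at hμ
  have hμ2 := hμ (ENNReal.ofReal (1 / 2)) (by simp)
  have hlt := hμ2.trans_lt (pos_iff_ne_zero.2 hδ0)
  simp only [iInf_lt_iff] at hlt
  obtain ⟨t, htE, htd, hts⟩ := hlt
  obtain ⟨η, hη, hηs⟩ := ENNReal.exists_pos_sum_of_countable' hδ0 ℕ
  choose m hm1 hm2 using fun n => radius_choice (Metric.ediam (t n)) (htd n) α h0 h1 (η n) (hη n).ne'
  have hx : ∀ n, ∃ x : TT, t n ⊆ Metric.ball x ((2 : ℝ)⁻¹ ^ m n) := by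
    intro n
    rcases (t n).eq_empty_or_nonempty with h | ⟨x, hx⟩
    · exact ⟨0, by simp [h]⟩
    · refine ⟨x, fun y hy => ?_⟩
      have := (Metric.edist_le_ediam_of_mem hy hx).trans_lt (hm1 n)
      rw [edist_dist] at this
      exact (ENNReal.ofReal_lt_ofReal_iff (by positivity)).1 this
  choose x hx using hx
  obtain ⟨S, hS⟩ := hE.elim_finite_subcover (fun n => Metric.ball (x n) ((2 : ℝ)⁻¹ ^ m n))
    (fun n => Metric.isOpen_ball) (htE.trans (iUnion_mono hx))
  obtain ⟨u, L, hL, g1, g2, g3, g4, g5⟩ := finite_bump _ K hK x m S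
  refine ⟨u, L, _, hL, g1, g2, g3, isOpen_biUnion fun i _ => Metric.isOpen_ball, hS, ?_, ?_⟩
  · intro y hy
    simp only [mem_iUnion] at hy
    obtain ⟨i, hi, hy⟩ := hy
    exact g4 i hi y hy
  · refine g5.trans (le_trans ?_ hδ)
    rw [← Finset.mul_sum]
    gcongr
    have e : 1 - 2 * ((1 - α) / 2) = α := by ring
    rw [e]
    have hd : ∀ n, Metric.ediam (t n) ^ α = ⨆ _ : (t n).Nonempty, Metric.ediam (t n) ^ α := by
      intro n
      rcases (t n).eq_empty_or_nonempty with h | h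
      · simp [h, h0]
      · simp [h]
    calc _ ≤ ∑ n ∈ S, (4 * Metric.ediam (t n) ^ α + η n) := Finset.sum_le_sum fun n _ => hm2 n
      _ ≤ ∑' n, (4 * Metric.ediam (t n) ^ α + η n) := ENNReal.sum_le_tsum S
      _ = 4 * (∑' n, ⨆ _ : (t n).Nonempty, Metric.ediam (t n) ^ α) + ∑' n, η n := by
          rw [ENNReal.tsum_add, ENNReal.tsum_mul_left]
          simp only [← hd]
      _ ≤ _ := by gcongr

/-- Fourier coefficient as a continuous linear map. -/
def fcL (n : ℤ) : C(TT, ℂ) →L[ℂ] ℂ :=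
  LinearMap.mkContinuous
    { toFun := fun g => fourierCoeff g n
      map_add' := fun g h => fc_add g h n
      map_smul' := fun r g => by
        have := fourierCoeff.const_smul (g : TT → ℂ) r n
        simpa using this } 1 (by
    intro g
    rw [one_mul]
    change ‖∫ t, fourier (-n) t • g t ∂AddCircle.haarAddCircle‖ ≤ ‖g‖
    have := norm_integral_le_of_norm_le_const
      (μ := (AddCircle.haarAddCircle : Measure TT)) (C := ‖g‖)
      (f := fun t => fourier (-n) t • g t) (Eventually.of_forall fun t => by
        rw [norm_smul]
        have h1 : ‖(fourier (-n) t : ℂ)‖ = 1 := Circle.norm_coe _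
        rw [h1, one_mul]
        exact ContinuousMap.norm_coe_le_norm g t)
    simpa using this)

lemma fcL_apply (n : ℤ) (g : C(TT, ℂ)) : fcL n g = fourierCoeff g n := rfl

lemma fc_fourier (k n : ℤ) : fourierCoeff (fourier k : C(TT, ℂ)) n = if n = k then 1 else 0 := by
  rw [fourierCoeff_fourier]
  simp [Pi.single_apply]

lemma fc_one (n : ℤ) : fourierCoeff (1 : C(TT, ℂ)) n = if n = 0 then 1 else 0 := by
  rw [← fc_fourier 0 n]
  congr 1
  ext t
  simp

/-- Trigonometric polynomial. -/
def trig (c : ℤ → ℂ) (S : Finset ℤ) : C(TT, ℂ) := ∑ k ∈ S, c k • fourier k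

lemma fc_trig (c : ℤ → ℂ) (S : Finset ℤ) (n : ℤ) :
    fourierCoeff (trig c S) n = if n ∈ S then c n else 0 := by
  rw [← fcL_apply, trig, map_sum]
  simp only [map_smul, fcL_apply, fc_fourier]
  simp

lemma NA_trunc (β : ℝ) (g : C(TT, ℂ)) (hg : NA β g ≠ ⊤) (η : ℝ≥0∞) (hη : η ≠ 0) :
    ∃ S : Finset ℤ, NA β (g - trig (fourierCoeff g) S) < η := by
  have h := ENNReal.tendsto_tsum_compl_atTop_zero hg
  obtain ⟨S, hS⟩ := (h.eventually (gt_mem_nhds (pos_iff_ne_zero.2 hη))).exists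
  refine ⟨S, lt_of_le_of_lt (le_of_eq ?_) hS⟩
  have := tsum_subtype {n : ℤ | n ∉ S} (fun n => ‖fourierCoeff g n‖ₑ * om n ^ β)
  refine Eq.trans ?_ this.symm
  unfold NA
  congr 1
  ext n
  rw [fc_sub, fc_trig]
  by_cases hn : n ∈ S
  · simp [hn]
  · simp [hn]

lemma exists_rep (z : TT) : ∃ h : ℝ, (h : TT) = z ∧ |h| = ‖z‖ := by
  induction z using QuotientAddGroup.induction_on with
  | H a =>
    refine ⟨a - round ((2 * Real.pi)⁻¹ * a) * (2 * Real.pi), ?_, ?_⟩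
    · have : ((round ((2 * Real.pi)⁻¹ * a) * (2 * Real.pi) : ℝ) : TT) = 0 := by
        rw [AddCircle.coe_eq_zero_iff]
        exact ⟨round ((2 * Real.pi)⁻¹ * a), by simp⟩
      rw [AddCircle.coe_sub, this, sub_zero]
    · exact (AddCircle.norm_eq (p := 2 * Real.pi)).symm

lemma fourier_lip (k : ℤ) (x y : TT) :
    ‖(fourier k x : ℂ) - fourier k y‖ ≤ |(k : ℝ)| * dist x y := by
  obtain ⟨h, hh, hn⟩ := exists_rep (x - y)
  have e : (fourier k x : ℂ) = fourier k y * fourier k (x - y) := by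
    simp only [fourier_apply, ← Circle.coe_mul, ← AddCircle.toCircle_add]
    congr 2
    rw [← smul_add]; congr 1; abel
  have e2 : (fourier k x : ℂ) - fourier k y = fourier k y * (fourier k (x - y) - 1) := by
    rw [e]; ring
  have h1 : ‖(fourier k y : ℂ)‖ = 1 := Circle.norm_coe _
  rw [e2, norm_mul, h1, one_mul, ← hh, fourier_real, dist_eq_norm, ← hn, ← abs_mul, mul_comm]
  have := Real.norm_exp_I_mul_ofReal_sub_one_le (x := k * h)
  simpa [mul_comm] using this

lemma trig_lip (c : ℤ → ℂ) (S : Finset ℤ) :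
    ∃ L : ℝ, 0 ≤ L ∧ ∀ x y, ‖trig c S x - trig c S y‖ ≤ L * dist x y := by
  refine ⟨∑ k ∈ S, ‖c k‖ * |(k : ℝ)|, by positivity, fun x y => ?_⟩
  have e : trig c S x - trig c S y = ∑ k ∈ S, c k * ((fourier k x : ℂ) - fourier k y) := by
    simp only [trig, ContinuousMap.coe_sum, Finset.sum_apply, ContinuousMap.smul_apply, smul_eq_mul,
      mul_sub, Finset.sum_sub_distrib]
  rw [e, Finset.sum_mul]
  refine (norm_sum_le _ _).trans (Finset.sum_le_sum fun k _ => ?_)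
  rw [norm_mul, mul_assoc]
  gcongr
  exact fourier_lip k x y

lemma enorm_le_NA (β : ℝ) (hβ : 0 ≤ β) (g : C(TT, ℂ)) (hg : NA β g ≠ ⊤) (x : TT) :
    ‖g x‖ₑ ≤ NA β g := by
  have h := has_pointwise_sum_fourier_series_of_summable (summable_fc β hβ g hg) x
  rw [← h.tsum_eq]
  refine enorm_tsum_le_tsum_enorm.trans ?_
  unfold NA
  refine ENNReal.tsum_le_tsum fun n => ?_
  have h1 : ‖(fourier n x : ℂ)‖ₑ = 1 := by
    rw [← ofReal_norm]
    have : ‖(fourier n x : ℂ)‖ = 1 := Circle.norm_coe _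
    rw [this]; simp
  rw [smul_eq_mul, enorm_mul, h1]
  gcongr
  simpa using ENNReal.rpow_le_rpow (one_le_om n) hβ

lemma NA_pow_mul (β : ℝ) (hβ : 0 ≤ β) (g h : C(TT, ℂ)) (hg : NA β g ≠ ⊤) (N : ℕ) :
    NA β (g ^ N * h) ≤ NA β g ^ N * NA β h := by
  induction N with
  | zero => simp
  | succ N ih =>
    rw [pow_succ', mul_assoc, pow_succ', mul_assoc]
    refine (NA_mul β hβ g _ hg).trans ?_
    gcongr

lemma pow_diff (a b : ℂ) (ρ κ : ℝ) (hρ : 0 ≤ ρ) (hκ : 0 ≤ κ) (ha : ‖a‖ ≤ ρ) (hb : ‖b‖ ≤ ρ)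
    (hab : ‖a - b‖ ≤ ρ * κ) (N : ℕ) : ‖a ^ N - b ^ N‖ ≤ N * ρ ^ N * κ := by
  induction N with
  | zero => simp
  | succ N ih =>
    have e : a ^ (N + 1) - b ^ (N + 1) = a * (a ^ N - b ^ N) + (a - b) * b ^ N := by ring
    rw [e]
    calc _ ≤ ‖a‖ * ‖a ^ N - b ^ N‖ + ‖a - b‖ * ‖b‖ ^ N := by
          refine (norm_add_le _ _).trans ?_
          rw [norm_mul, norm_mul, norm_pow]
      _ ≤ ρ * (N * ρ ^ N * κ) + (ρ * κ) * ρ ^ N := by gcongr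
      _ = _ := by push_cast; ring

lemma newman_lip (v : TT → ℝ) (L : ℝ) (hL : 0 ≤ L) (hv : ∀ x y, ‖v x - v y‖ ≤ L * dist x y)
    (hv0 : ∀ x, 0 ≤ v x) (hv1 : ∀ x, v x ≤ 1) (P : TT → ℂ) (LP : ℝ) (hLP : 0 ≤ LP)
    (hP : ∀ x y, ‖P x - P y‖ ≤ LP * dist x y) (η : ℝ) (hη : 0 < η)
    (hPη : ∀ x, v x ≠ 0 → η ≤ ‖P x‖) (N : ℕ) :
    (∀ x, ‖(v x : ℂ) * (P x)⁻¹ ^ N‖ ≤ η⁻¹ ^ N) ∧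
    ∀ x y, ‖(v x : ℂ) * (P x)⁻¹ ^ N - (v y : ℂ) * (P y)⁻¹ ^ N‖ ≤
      (η⁻¹ ^ N * (L + N * (η⁻¹ * LP))) * dist x y := by
  have hinv : ∀ x, v x ≠ 0 → ‖(P x)⁻¹‖ ≤ η⁻¹ := by
    intro x hx
    rw [norm_inv]
    exact inv_anti₀ hη (hPη x hx)
  have hvn : ∀ x, ‖(v x : ℂ)‖ = v x := fun x => by
    rw [Complex.norm_real, Real.norm_eq_abs, abs_of_nonneg (hv0 x)]
  have hbd : ∀ x, ‖(v x : ℂ) * (P x)⁻¹ ^ N‖ ≤ v x * η⁻¹ ^ N := by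
    intro x
    by_cases hx : v x = 0
    · simp [hx]
    · rw [norm_mul, norm_pow, hvn]
      have := hinv x hx
      have := hv0 x
      gcongr
  have hη' : 0 < η⁻¹ := inv_pos.2 hη
  have hone : ∀ x y, v x = 0 → ‖(v y : ℂ) * (P y)⁻¹ ^ N‖ ≤
      (η⁻¹ ^ N * (L + N * (η⁻¹ * LP))) * dist x y := by
    intro x y hx
    refine (hbd y).trans ?_
    have h1 := hv x y
    rw [hx, zero_sub, norm_neg, Real.norm_eq_abs, abs_of_nonneg (hv0 y)] at h1
    calc v y * η⁻¹ ^ N ≤ (L * dist x y) * η⁻¹ ^ N := by gcongr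
      _ ≤ (L * dist x y) * η⁻¹ ^ N + η⁻¹ ^ N * (N * (η⁻¹ * LP)) * dist x y :=
          le_add_of_nonneg_right (by positivity)
      _ = _ := by ring
  refine ⟨fun x => (hbd x).trans (mul_le_of_le_one_left (by positivity) (hv1 x)), fun x y => ?_⟩
  by_cases hx : v x = 0
  · have := hone x y hx
    rw [hx]
    simpa using this
  by_cases hy : v y = 0
  · have := hone y x hy
    rw [hy, dist_comm]
    simpa using this
  have hPx : P x ≠ 0 := by
    intro h0; have := hPη x hx; rw [h0, norm_zero] at this; linarith
  have hPy : P y ≠ 0 := by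
    intro h0; have := hPη y hy; rw [h0, norm_zero] at this; linarith
  have hab : ‖(P x)⁻¹ - (P y)⁻¹‖ ≤ η⁻¹ * (η⁻¹ * LP * dist x y) := by
    have e : (P x)⁻¹ - (P y)⁻¹ = (P x)⁻¹ * (P y)⁻¹ * (P y - P x) := by field_simp
    rw [e, norm_mul, norm_mul]
    calc _ ≤ η⁻¹ * η⁻¹ * (LP * dist x y) := by
          gcongr
          · exact hinv x hx
          · exact hinv y hy
          · rw [dist_comm]; exact hP y x
      _ = _ := by ring
  have hpd := pow_diff _ _ η⁻¹ (η⁻¹ * LP * dist x y) hη'.le (by positivity) (hinv x hx) (hinv y hy)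
    hab N
  have e : (v x : ℂ) * (P x)⁻¹ ^ N - (v y : ℂ) * (P y)⁻¹ ^ N =
      (v x : ℂ) * ((P x)⁻¹ ^ N - (P y)⁻¹ ^ N) + ((v x - v y : ℝ) : ℂ) * (P y)⁻¹ ^ N := by
    push_cast; ring
  rw [e]
  calc _ ≤ ‖(v x : ℂ)‖ * ‖(P x)⁻¹ ^ N - (P y)⁻¹ ^ N‖ + ‖v x - v y‖ * ‖(P y)⁻¹‖ ^ N := by
        refine (norm_add_le _ _).trans ?_
        rw [norm_mul, norm_mul, norm_pow, Complex.norm_real (v x - v y)]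
    _ ≤ 1 * (N * η⁻¹ ^ N * (η⁻¹ * LP * dist x y)) + (L * dist x y) * η⁻¹ ^ N := by
        gcongr
        · rw [hvn]; exact hv1 x
        · exact hv x y
        · exact hinv y hy
    _ = _ := by ring

lemma newman (β : ℝ) (hβ0 : 0 ≤ β) (hβ : β < 1 / 2)
    (v : TT → ℝ) (L : ℝ) (hL : 0 ≤ L) (hv : ∀ x y, ‖v x - v y‖ ≤ L * dist x y)
    (hv0 : ∀ x, 0 ≤ v x) (hv1 : ∀ x, v x ≤ 1) (F : C(TT, ℂ)) (hF : NA β F ≠ ⊤)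
    (δ : ℝ) (hδ : 0 < δ) (hFδ : ∀ x, v x ≠ 0 → δ ≤ ‖F x‖) (ε : ℝ≥0∞) (hε : ε ≠ 0) :
    ∃ g e : C(TT, ℂ), NA β g ≠ ⊤ ∧ NA β e < ε ∧ ∀ x, (v x : ℂ) - g x * F x = e x := by
  obtain ⟨S, hS⟩ := NA_trunc β F hF (ENNReal.ofReal (δ / 3)) (by simp; linarith)
  set P := trig (fourierCoeff F) S with hP
  obtain ⟨LP, hLP, hPl⟩ := trig_lip (fourierCoeff F) S
  rw [← hP] at hPl
  set D : C(TT, ℂ) := F - P with hD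
  have hDt : NA β D ≠ ⊤ := ne_top_of_lt hS
  set η : ℝ := 2 * δ / 3 with hη
  have hη0 : 0 < η := by positivity
  have hPη : ∀ x, v x ≠ 0 → η ≤ ‖P x‖ := by
    intro x hx
    have h1 := (enorm_le_NA β hβ0 D hDt x).trans_lt hS
    rw [← ofReal_norm, ENNReal.ofReal_lt_ofReal_iff (by positivity)] at h1
    have h2 : F x = P x + D x := by simp [hD]
    have h3 := hFδ x hx
    rw [h2] at h3
    have := norm_add_le (P x) (D x)
    rw [hη]; linarith
  have hlip := newman_lip v L hL hv hv0 hv1 P LP hLP hPl η hη0 hPη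
  have hη' : 0 < η⁻¹ := inv_pos.2 hη0
  set Φ : ℕ → C(TT, ℂ) := fun N => ⟨fun x => (v x : ℂ) * (P x)⁻¹ ^ N,
    continuous_of_lip _ (η⁻¹ ^ N * (L + N * (η⁻¹ * LP))) (by positivity) (hlip N).2⟩ with hΦ
  have hΦa : ∀ N x, Φ N x = (v x : ℂ) * (P x)⁻¹ ^ N := fun N x => rfl
  set s : ℝ := (1 / 2 + β + 1) / 2 with hs
  obtain ⟨K1, hK1t, hK1⟩ := NP_le_Q 1 β s le_rfl (by norm_num) (by rw [hs]; linarith)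
    (by rw [hs]; linarith) (by rw [hs]; linarith)
  obtain ⟨K2, hK2t, hK2⟩ := Q_lip s (by rw [hs]; linarith)
  have hNA : ∀ N, NA β (Φ N) ≤ K1 * K2 ^ (1 / 2 : ℝ) *
      ENNReal.ofReal (η⁻¹ ^ N * (1 + L + N * (η⁻¹ * LP))) := by
    intro N
    rw [NA_eq_NP]
    refine (hK1 _).trans ?_
    have h1 := hK2 (Φ N) (η⁻¹ ^ N) (η⁻¹ ^ N * (L + N * (η⁻¹ * LP))) (by positivity) (by positivity)
      (hlip N).1 (hlip N).2
    have e1 : η⁻¹ ^ N + η⁻¹ ^ N * (L + N * (η⁻¹ * LP)) = η⁻¹ ^ N * (1 + L + N * (η⁻¹ * LP)) := by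
      ring
    rw [e1] at h1
    rw [mul_assoc]
    gcongr
    calc Q s (Φ N) ^ (1 / 2 : ℝ) ≤ _ := ENNReal.rpow_le_rpow h1 (by norm_num)
      _ = _ := by
        rw [ENNReal.mul_rpow_of_nonneg _ _ (by norm_num),
          ENNReal.ofReal_rpow_of_nonneg (by positivity) (by norm_num), ← Real.sqrt_eq_rpow,
          Real.sqrt_sq (by positivity)]
  have hKt : K1 * K2 ^ (1 / 2 : ℝ) ≠ ⊤ :=
    ENNReal.mul_ne_top hK1t (ENNReal.rpow_ne_top_of_nonneg (by norm_num) hK2t)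
  have hNAt : ∀ N, NA β (Φ N) ≠ ⊤ := fun N =>
    ne_top_of_le_ne_top (ENNReal.mul_ne_top hKt ENNReal.ofReal_ne_top) (hNA N)
  have hmt : NA β (-D) = NA β D := by
    unfold NA
    congr 1; ext n
    rw [fc_neg, enorm_neg]
  have herr : ∀ N, NA β ((-D) ^ N * Φ N) ≤ K1 * K2 ^ (1 / 2 : ℝ) *
      ENNReal.ofReal ((1 / 2 : ℝ) ^ N * (1 + L + N * (η⁻¹ * LP))) := by
    intro N
    refine (NA_pow_mul β hβ0 _ _ (by rw [hmt]; exact hDt) N).trans ?_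
    rw [hmt]
    calc _ ≤ ENNReal.ofReal (δ / 3) ^ N * (K1 * K2 ^ (1 / 2 : ℝ) *
          ENNReal.ofReal (η⁻¹ ^ N * (1 + L + N * (η⁻¹ * LP)))) := by
          gcongr
          exact hNA N
      _ = K1 * K2 ^ (1 / 2 : ℝ) * (ENNReal.ofReal ((δ / 3) ^ N) *
          ENNReal.ofReal (η⁻¹ ^ N * (1 + L + N * (η⁻¹ * LP)))) := by
          rw [ENNReal.ofReal_pow (by positivity)]; ring
      _ = _ := by
          have e5 : δ / 3 * η⁻¹ = 1 / 2 := by rw [hη]; field_simp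
          rw [← ENNReal.ofReal_mul (by positivity), ← mul_assoc ((δ / 3) ^ N), ← mul_pow, e5]
  have hlim : Tendsto (fun N : ℕ => K1 * K2 ^ (1 / 2 : ℝ) *
      ENNReal.ofReal ((1 / 2 : ℝ) ^ N * (1 + L + N * (η⁻¹ * LP)))) atTop (𝓝 0) := by
    have h1 : Tendsto (fun N : ℕ => (1 / 2 : ℝ) ^ N * (1 + L + N * (η⁻¹ * LP))) atTop (𝓝 0) := by
      have a1 : Tendsto (fun N : ℕ => (1 / 2 : ℝ) ^ N) atTop (𝓝 0) :=
        tendsto_pow_atTop_nhds_zero_of_lt_one (by norm_num) (by norm_num)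
      have a2 : Tendsto (fun N : ℕ => (N : ℝ) * (1 / 2 : ℝ) ^ N) atTop (𝓝 0) :=
        tendsto_self_mul_const_pow_of_lt_one (by norm_num) (by norm_num)
      have a3 := (a1.mul_const (1 + L)).add (a2.mul_const (η⁻¹ * LP))
      simp only [zero_mul, add_zero] at a3
      refine a3.congr fun N => ?_
      ring
    have h2 := ENNReal.Tendsto.const_mul (a := K1 * K2 ^ (1 / 2 : ℝ)) (ENNReal.tendsto_ofReal h1)
      (Or.inr hKt)
    simpa using h2
  obtain ⟨N, hN⟩ := (hlim.eventually (gt_mem_nhds (pos_iff_ne_zero.2 hε))).exists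
  refine ⟨∑ k ∈ Finset.range N, (-D) ^ k * Φ (k + 1), (-D) ^ N * Φ N, ?_,
    (herr N).trans_lt hN, ?_⟩
  · clear hN
    induction N with
    | zero => simp [NA, fourierCoeff]
    | succ N ih =>
      rw [Finset.sum_range_succ]
      refine ne_top_of_le_ne_top ?_ (NA_add β _ _)
      refine ENNReal.add_ne_top.2 ⟨ih, ?_⟩
      refine ne_top_of_le_ne_top ?_ (NA_pow_mul β hβ0 _ _ (by rw [hmt]; exact hDt) N)
      rw [hmt]
      exact ENNReal.mul_ne_top (ENNReal.pow_ne_top hDt) (hNAt _)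
  · intro x
    clear hN
    induction N with
    | zero => simp [hΦa]
    | succ N ih =>
      rw [Finset.sum_range_succ, ContinuousMap.add_apply, add_mul, ← sub_sub, ih]
      simp only [ContinuousMap.mul_apply, ContinuousMap.pow_apply, ContinuousMap.neg_apply, hΦa]
      by_cases hx : v x = 0
      · simp [hx]
      have hPx : P x ≠ 0 := by
        intro h0; have := hPη x hx; rw [h0, norm_zero] at this; linarith
      have h2 : F x = P x + D x := by simp [hD]
      rw [h2, pow_succ (-D x), pow_succ (P x)⁻¹]
      have h3 : (P x)⁻¹ * P x = 1 := inv_mul_cancel₀ hPx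
      linear_combination (- (-D x) ^ N * (v x : ℂ) * (P x)⁻¹ ^ N) * h3

/-- The continuous function with coefficients `c`. -/
lemma exists_F (β : ℝ) (hβ : 0 ≤ β) (c : ℤ → ℂ) (hc : MemA 1 β c) :
    ∃ F : C(TT, ℂ), (∀ t, F t = fSum c t) ∧ (∀ n, fourierCoeff F n = c n) ∧ NA β F ≠ ⊤ := by
  unfold MemA at hc
  simp only [Real.rpow_one, one_mul] at hc
  have hcs : Summable fun n => ‖c n‖ := by
    refine Summable.of_nonneg_of_le (fun _ => norm_nonneg _) (fun n => ?_) hc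
    apply le_mul_of_one_le_right (norm_nonneg _)
    exact Real.one_le_rpow (by linarith [abs_nonneg (n : ℝ)]) hβ
  have hs : Summable fun n => c n • (fourier n : C(TT, ℂ)) := by
    apply Summable.of_norm
    refine hcs.congr fun n => ?_
    rw [norm_smul, fourier_norm, mul_one]
  have hsum := hs.hasSum
  have hfc : ∀ n, fourierCoeff (∑' n, c n • (fourier n : C(TT, ℂ)) : C(TT, ℂ)) n = c n := by
    intro n
    have h := (fcL n).hasSum hsum
    simp only [map_smul, fcL_apply, fc_fourier] at h
    rw [← h.tsum_eq]
    simp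
  refine ⟨∑' n, c n • fourier n, fun t => ?_, hfc, ?_⟩
  · have h := (ContinuousMap.evalCLM ℂ t : C(TT, ℂ) →L[ℂ] ℂ).hasSum hsum
    exact h.tsum_eq.symm
  · unfold NA
    simp only [hfc]
    have e : ∀ n : ℤ, ‖c n‖ₑ * om n ^ β = ENNReal.ofReal (‖c n‖ * (1 + |(n : ℝ)|) ^ β) := by
      intro n
      rw [ENNReal.ofReal_mul (norm_nonneg _), ofReal_norm, om,
        ENNReal.ofReal_rpow_of_pos (by positivity)]
    simp only [e]
    exact hc.tsum_ofReal_ne_top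

lemma Q_ofReal (s : ℝ) (u : TT → ℝ) : Q s (fun x => (u x : ℂ)) = Q s u := by
  have h : ∀ t : ℝ, ‖(t : ℂ)‖ₑ = ‖t‖ₑ := fun t => by
    rw [← ofReal_norm, ← ofReal_norm, Complex.norm_real]
  unfold Q
  simp only [← Complex.ofReal_sub, h]

/-- Theorem A(1) / Theorem 3.3(1): if `1 < p < 2`, `β > 0`,
`βq ≤ 1` where `q = p/(p-1)`, `f ∈ A^1_β(𝕋)` and
`dim Z(f) < (2/q)(1 - βq)`, then `f` is cyclic in `A^p_β(𝕋)`. -/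
theorem stmt0 (p q β : ℝ) (hp1 : 1 < p) (hp2 : p < 2) (hβ : 0 < β)
    (hq : q = p / (p - 1)) (hβq : β * q ≤ 1)
    (c : ℤ → ℂ) (hc : MemA 1 β c)
    (hdim : dimH (zeroSet c) < ENNReal.ofReal ((2 / q) * (1 - β * q))) :
    IsCyclicA p β c := by
  have hp0 : 0 < p := by linarith
  have hq2 : 2 < q := by
    rw [hq, lt_div_iff₀ (by linarith)]; linarith
  have hq0 : 0 < q := by linarith
  have hpq : 1 / p = 1 - 1 / q := by
    rw [hq]; field_simp; ring
  have hβ2 : β < 1 / 2 := by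
    by_contra hcon
    push Not at hcon
    nlinarith
  obtain ⟨α, hα1, hα2⟩ := ENNReal.lt_iff_exists_nnreal_btwn.1 hdim
  have hα0 : (0 : ℝ) < α := by
    have : (0 : ℝ≥0∞) < α := lt_of_le_of_lt zero_le hα1
    exact_mod_cast this
  have hαX : (α : ℝ) < (2 / q) * (1 - β * q) := by
    rw [← ENNReal.ofReal_coe_nnreal] at hα2
    exact (ENNReal.ofReal_lt_ofReal_iff_of_nonneg hα0.le).1 hα2
  have hX : (2 / q) * (1 - β * q) = 2 * (1 / q) - 2 * β := by field_simp
  rw [hX] at hαX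
  have h1q : 1 / q < 1 / 2 := one_div_lt_one_div_of_lt (by norm_num) hq2
  have hα1' : (α : ℝ) < 1 := by linarith
  obtain ⟨F, hFs, hFc, hFt⟩ := exists_F β hβ.le c hc
  have hEc : IsCompact (zeroSet c) := by
    have : zeroSet c = F ⁻¹' {0} := by
      ext t; simp [zeroSet, hFs]
    rw [this]
    exact (isClosed_singleton.preimage F.continuous).isCompact
  have hμ := hausdorffMeasure_of_dimH_lt hα1
  obtain ⟨K, hKt, hK⟩ := NP_le_Q p β ((1 - α) / 2) hp1.le hp2 (by linarith) (by linarith)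
    (by rw [hpq]; linarith)
  intro ε hε
  set ε3 : ℝ≥0∞ := ENNReal.ofReal (ε / 3) with hε3
  have hε30 : ε3 ≠ 0 := by rw [hε3]; simp; linarith
  obtain ⟨ε1, hε10, hε1⟩ : ∃ ε1 : ℝ≥0∞, ε1 ≠ 0 ∧ K * ε1 ^ (1 / 2 : ℝ) < ε3 := by
    have ht : Tendsto (fun δ : ℝ≥0∞ => K * δ ^ (1 / 2 : ℝ)) (𝓝 0) (𝓝 (K * 0 ^ (1 / 2 : ℝ))) :=
      ENNReal.Tendsto.const_mul (ENNReal.continuous_rpow_const.tendsto 0) (Or.inr hKt)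
    rw [ENNReal.zero_rpow_of_pos (by norm_num), mul_zero] at ht
    have h2 := ht.eventually (gt_mem_nhds (pos_iff_ne_zero.2 hε30))
    have h3 : ∀ᶠ δ in 𝓝[>] (0 : ℝ≥0∞), K * δ ^ (1 / 2 : ℝ) < ε3 :=
      h2.filter_mono nhdsWithin_le_nhds
    obtain ⟨δ, hδ, hδ2⟩ := (h3.and self_mem_nhdsWithin).exists
    exact ⟨δ, ne_of_gt hδ2, hδ⟩
  obtain ⟨u, L, U, hL, hul, hu0, hu1, hUo, hEU, huU, hQ⟩ :=
    small_bump α hα0 hα1' (zeroSet c) hEc hμ ε1 hε10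
  obtain ⟨δ, hδ, hFδ⟩ := hUo.isClosed_compl.isCompact.exists_forall_le' (f := fun x => ‖F x‖)
    (a := 0) (by fun_prop) (fun x hx => by
      rw [norm_pos_iff]
      intro h0
      exact hx (hEU (by rw [zeroSet, mem_setOf_eq, ← hFs, h0])))
  obtain ⟨g, e, hg, he, hge⟩ := newman β hβ.le hβ2 (fun x => 1 - u x) L hL
    (fun x y => by
      have : (1 - u x) - (1 - u y) = u y - u x := by ring
      rw [this, dist_comm]; exact hul y x)
    (fun x => by linarith [hu1 x]) (fun x => by linarith [hu0 x]) F hFt δ hδ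
    (fun x hx => hFδ x (fun hxU => hx (by beta_reduce; rw [huU x hxU]; ring))) ε3 hε30
  obtain ⟨ε2, hε20, hε2⟩ : ∃ ε2 : ℝ≥0∞, ε2 ≠ 0 ∧ ε2 * NA β F ≤ ε3 := by
    refine ⟨ε3 / (NA β F + 1), ?_, ?_⟩
    · exact (ENNReal.div_pos hε30 (by finiteness)).ne'
    · rw [← ENNReal.mul_div_right_comm]
      apply ENNReal.div_le_of_le_mul
      gcongr
      exact le_self_add
  obtain ⟨S, hS⟩ := NA_trunc β g hg ε2 hε20
  refine ⟨fun n => if n ∈ S then fourierCoeff g n else 0, ?_, ?_⟩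
  · refine S.finite_toSet.subset fun n hn => ?_
    by_contra hcon
    exact hn (if_neg hcon)
  set A := trig (fourierCoeff g) S with hA
  have hAc : ∀ n, fourierCoeff A n = if n ∈ S then fourierCoeff g n else 0 := fc_trig _ S
  have hAs : Summable (fourierCoeff A) := by
    apply summable_of_ne_finset_zero (s := S)
    intro n hn
    rw [hAc, if_neg hn]
  have hcoef : (fun n : ℤ => (if n = 0 then (1 : ℂ) else 0) -
      convSeq (fun n => if n ∈ S then fourierCoeff g n else 0) c n) =
      fourierCoeff (1 - A * F : C(TT, ℂ)) := by
    ext n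
    rw [fc_sub, fc_one, fc_mul A F hAs]
    simp only [hAc, hFc]
    rfl
  rw [hcoef, normA_eq p β hp1.le]
  set uC : C(TT, ℂ) := ⟨fun x => (u x : ℂ),
    Complex.continuous_ofReal.comp (continuous_of_lip u L hL hul)⟩ with huC
  have hdec : (1 - A * F : C(TT, ℂ)) = uC + (e + (g - A) * F) := by
    ext x
    have h1 := hge x
    push_cast at h1
    simp only [ContinuousMap.sub_apply, ContinuousMap.add_apply, ContinuousMap.mul_apply,
      ContinuousMap.one_apply]
    have h2 : uC x = (u x : ℂ) := rfl
    rw [h2, ← h1]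
    ring
  have hu : NP p β uC < ε3 := by
    refine lt_of_le_of_lt ((hK uC).trans ?_) hε1
    have : Q ((1 - α) / 2) uC = Q ((1 - α) / 2) u := Q_ofReal _ u
    rw [this]
    gcongr
  have hrest : NP p β (e + (g - A) * F) ≤ ε3 + ε3 := by
    refine (NP_le_NA p β hp1.le _).trans ((NA_add β _ _).trans ?_)
    gcongr
    refine (NA_mul β hβ.le _ _ (ne_top_of_lt hS)).trans (le_trans ?_ hε2)
    gcongr
  have hε3t : ε3 ≠ ⊤ := ENNReal.ofReal_ne_top
  have hfin : NP p β (1 - A * F) < ENNReal.ofReal ε := by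
    rw [hdec]
    refine (NP_add p β hp1.le _ _).trans_lt ?_
    have e3 : ENNReal.ofReal ε = ε3 + (ε3 + ε3) := by
      rw [hε3, ← ENNReal.ofReal_add (by positivity) (by positivity),
        ← ENNReal.ofReal_add (by positivity) (by positivity)]
      congr 1; ring
    rw [e3]
    exact ENNReal.add_lt_add_of_lt_of_le (ne_top_of_le_ne_top (by finiteness) hrest) hu hrest
  exact (ENNReal.toReal_lt_toReal (ne_top_of_lt hfin) ENNReal.ofReal_ne_top).2 hfin |>.trans_eq
    (ENNReal.toReal_ofReal hε.le)

end
end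

section
/- Let 1 < p < 2 and β > 0 with βq ≤ 1, where q = p/(p−1). For every α with (2/q)(1 − βq) < α ≤ 1, there exists a closed set E ⊆ 𝕋 such that dim(E) = α and every f ∈ A^1_β(𝕋) satisfying Z(f) = E is not cyclic in A^p_β(𝕋). -/
open MeasureTheory Real Set Filter Topology ENNReal

noncomputable section

theorem wh_tsum {ι : Type*} {q : ℝ} (hq : 1 ≤ q) (w f : ι → ℝ≥0∞) :
    (∑' i, w i * f i) ^ q ≤ (∑' i, w i) ^ (q - 1) * ∑' i, w i * f i ^ q := by
  have hq0 : 0 < q := by linarith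
  have h1 : ∑' i, w i * f i ≤ (∑' i, w i) ^ (1 - q⁻¹) * (∑' i, w i * f i ^ q) ^ q⁻¹ := by
    rw [ENNReal.tsum_eq_iSup_sum]
    refine iSup_le fun s => (ENNReal.inner_le_weight_mul_Lp_of_nonneg s hq w f).trans ?_
    have : 0 ≤ 1 - q⁻¹ := by
      have := inv_le_one_of_one_le₀ hq
      linarith
    gcongr
    · exact ENNReal.sum_le_tsum s
    · exact ENNReal.sum_le_tsum s
  calc _ ≤ ((∑' i, w i) ^ (1 - q⁻¹) * (∑' i, w i * f i ^ q) ^ q⁻¹) ^ q := by gcongr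
    _ = _ := by
      rw [ENNReal.mul_rpow_of_nonneg _ _ hq0.le, ← ENNReal.rpow_mul, ← ENNReal.rpow_mul,
        inv_mul_cancel₀ hq0.ne', ENNReal.rpow_one, sub_mul, inv_mul_cancel₀ hq0.ne', one_mul]

theorem young_enn {q : ℝ} (hq : 1 ≤ q) (A B : ℤ → ℝ≥0∞) :
    ∑' n, (∑' k, A k * B (n - k)) ^ q ≤
      (∑' k, A k) ^ (q - 1) * ((∑' k, A k) * ∑' n, B n ^ q) := by
  calc _ ≤ ∑' n, (∑' k, A k) ^ (q - 1) * ∑' k, A k * B (n - k) ^ q :=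
        ENNReal.tsum_le_tsum fun n => wh_tsum hq A fun k => B (n - k)
    _ = (∑' k, A k) ^ (q - 1) * ∑' n, ∑' k, A k * B (n - k) ^ q := ENNReal.tsum_mul_left
    _ = (∑' k, A k) ^ (q - 1) * ∑' k, ∑' n, A k * B (n - k) ^ q := by rw [ENNReal.tsum_comm]
    _ = _ := by
      congr 1
      rw [← ENNReal.tsum_mul_right]
      congr 1; ext k
      rw [ENNReal.tsum_mul_left]
      congr 1
      exact (Equiv.subRight k).tsum_eq (fun n => B n ^ q)

theorem weight_le (γ : ℝ) (n k : ℤ) :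
    (1 + |(n : ℝ)|) ^ γ ≤ (1 + |(k : ℝ)|) ^ |γ| * (1 + |((n - k : ℤ) : ℝ)|) ^ γ := by
  have hk : 0 < 1 + |(k : ℝ)| := by positivity
  have hn : 0 < 1 + |(n : ℝ)| := by positivity
  have hnk : 0 < 1 + |((n - k : ℤ) : ℝ)| := by positivity
  rcases le_total 0 γ with h | h
  · rw [abs_of_nonneg h, ← Real.mul_rpow hk.le hnk.le]
    apply Real.rpow_le_rpow hn.le _ h
    have : |(n : ℝ)| ≤ |(k : ℝ)| + |((n - k : ℤ) : ℝ)| := by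
      push_cast
      calc |(n : ℝ)| = |(k : ℝ) + (n - k)| := by ring_nf
        _ ≤ _ := abs_add_le _ _
    nlinarith [abs_nonneg (k : ℝ), abs_nonneg ((n - k : ℤ) : ℝ), mul_nonneg (abs_nonneg (k : ℝ)) (abs_nonneg ((n - k : ℤ) : ℝ))]
  · obtain ⟨δ, rfl⟩ : ∃ δ, γ = -δ := ⟨-γ, by ring⟩
    have hδ : 0 ≤ δ := by linarith
    rw [abs_neg, abs_of_nonneg hδ, Real.rpow_neg hn.le, Real.rpow_neg hnk.le, ← div_eq_mul_inv,
      le_div_iff₀ (by positivity), inv_mul_le_iff₀ (by positivity), ← Real.mul_rpow hn.le hk.le]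
    apply Real.rpow_le_rpow hnk.le _ hδ
    have : |((n - k : ℤ) : ℝ)| ≤ |(n : ℝ)| + |(k : ℝ)| := by
      push_cast
      exact abs_sub _ _
    nlinarith [mul_nonneg (abs_nonneg (k : ℝ)) (abs_nonneg (n : ℝ))]

/-- the ENNReal version of the weighted sum -/
def eSum (q γ : ℝ) (c : ℤ → ℂ) : ℝ≥0∞ :=
  ∑' n : ℤ, ENNReal.ofReal (‖c n‖ * (1 + |(n : ℝ)|) ^ γ) ^ q

theorem eterm (q γ : ℝ) (hq : 0 ≤ q) (c : ℤ → ℂ) (n : ℤ) :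
    ENNReal.ofReal (‖c n‖ * (1 + |(n : ℝ)|) ^ γ) ^ q =
      ENNReal.ofReal (‖c n‖ ^ q * (1 + |(n : ℝ)|) ^ (q * γ)) := by
  rw [ENNReal.ofReal_rpow_of_nonneg (by positivity) hq, Real.mul_rpow (by positivity) (by positivity),
    ← Real.rpow_mul (by positivity), mul_comm γ q]

theorem eSum_eq (q γ : ℝ) (hq : 0 ≤ q) (c : ℤ → ℂ) (h : MemA q γ c) :
    eSum q γ c = ENNReal.ofReal (wSum q γ c) := by
  unfold eSum wSum
  simp_rw [eterm q γ hq]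
  rw [ENNReal.ofReal_tsum_of_nonneg (fun n => by positivity) h]

theorem memA_of_eSum (q γ : ℝ) (hq : 0 ≤ q) (c : ℤ → ℂ) (h : eSum q γ c ≠ ⊤) : MemA q γ c := by
  unfold eSum at h
  simp_rw [eterm q γ hq] at h
  unfold MemA
  have := ENNReal.summable_toReal h
  refine this.congr fun n => ?_
  rw [ENNReal.toReal_ofReal (by positivity)]

theorem wSum_nonneg (q γ : ℝ) (c : ℤ → ℂ) : 0 ≤ wSum q γ c :=
  tsum_nonneg fun n => by positivity

theorem eSum_conv {q : ℝ} (hq : 1 ≤ q) (γ : ℝ) (a b : ℤ → ℂ) :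
    eSum q γ (convSeq a b) ≤ eSum 1 |γ| a ^ (q - 1) * (eSum 1 |γ| a * eSum q γ b) := by
  refine le_trans ?_ ((young_enn hq (fun k => ENNReal.ofReal (‖a k‖ * (1 + |(k : ℝ)|) ^ |γ|))
    (fun k => ENNReal.ofReal (‖b k‖ * (1 + |(k : ℝ)|) ^ γ))).trans ?_)
  · refine ENNReal.tsum_le_tsum fun n => ?_
    refine ENNReal.rpow_le_rpow ?_ (by linarith)
    rw [ENNReal.ofReal_mul (norm_nonneg _), ofReal_norm]
    calc _ ≤ (∑' k, ‖a k * b (n - k)‖ₑ) * ENNReal.ofReal ((1 + |(n : ℝ)|) ^ γ) := by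
          gcongr
          exact enorm_tsum_le_tsum_enorm
      _ = ∑' k, ‖a k * b (n - k)‖ₑ * ENNReal.ofReal ((1 + |(n : ℝ)|) ^ γ) :=
          ENNReal.tsum_mul_right.symm
      _ ≤ _ := by
          refine ENNReal.tsum_le_tsum fun k => ?_
          rw [← ofReal_norm, ← ENNReal.ofReal_mul (norm_nonneg _),
            ← ENNReal.ofReal_mul (by positivity)]
          apply ENNReal.ofReal_le_ofReal
          rw [norm_mul]
          calc _ ≤ ‖a k‖ * ‖b (n - k)‖ * ((1 + |(k : ℝ)|) ^ |γ| * (1 + |((n - k : ℤ) : ℝ)|) ^ γ) := by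
                gcongr
                exact weight_le γ n k
            _ = _ := by ring
  · simp [eSum]

/-- Weighted Young inequality. -/
theorem young_A {q : ℝ} (hq : 1 ≤ q) (γ : ℝ) (a : ℤ → ℂ) (ha : MemA 1 |γ| a) :
    ∃ D : ℝ, 0 ≤ D ∧ ∀ b, MemA q γ b → MemA q γ (convSeq a b) ∧
      wSum q γ (convSeq a b) ≤ D * wSum q γ b := by
  have hA : eSum 1 |γ| a ≠ ⊤ := by
    rw [eSum_eq 1 _ (by norm_num) a ha]; exact ENNReal.ofReal_ne_top
  set T := eSum 1 |γ| a ^ (q - 1) * eSum 1 |γ| a with hT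
  have hTt : T ≠ ⊤ := ENNReal.mul_ne_top (ENNReal.rpow_ne_top_of_nonneg (by linarith) hA) hA
  refine ⟨T.toReal, ENNReal.toReal_nonneg, fun b hb => ?_⟩
  have h1 := eSum_conv hq γ a b
  rw [← mul_assoc, ← hT, eSum_eq q γ (by linarith) b hb] at h1
  have h2 : MemA q γ (convSeq a b) :=
    memA_of_eSum q γ (by linarith) _ (ne_top_of_le_ne_top (ENNReal.mul_ne_top hTt ENNReal.ofReal_ne_top) h1)
  refine ⟨h2, ?_⟩
  rw [eSum_eq q γ (by linarith) _ h2, ← ENNReal.ofReal_toReal hTt, ← ENNReal.ofReal_mul ENNReal.toReal_nonneg] at h1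
  exact (ENNReal.ofReal_le_ofReal_iff (mul_nonneg ENNReal.toReal_nonneg (wSum_nonneg _ _ _))).1 h1

theorem memA_conv {β : ℝ} (hβ : 0 ≤ β) (a b : ℤ → ℂ) (ha : MemA 1 β a) (hb : MemA 1 β b) :
    MemA 1 β (convSeq a b) := by
  obtain ⟨D, -, h⟩ := young_A le_rfl β a (by rwa [abs_of_nonneg hβ])
  exact (h b hb).1

theorem memA_summable {β : ℝ} (hβ : 0 ≤ β) (a : ℤ → ℂ) (ha : MemA 1 β a) :
    Summable fun n => ‖a n‖ := by
  refine ha.of_nonneg_of_le (fun n => norm_nonneg _) fun n => ?_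
  rw [Real.rpow_one, one_mul]
  have : 1 ≤ (1 + |(n : ℝ)|) ^ β := Real.one_le_rpow (by linarith [abs_nonneg (n : ℝ)]) hβ
  nlinarith [norm_nonneg (a n)]

theorem memA_of_one {p β : ℝ} (hp : 1 ≤ p) (a : ℤ → ℂ) (ha : MemA 1 β a) : MemA p β a := by
  have ha' : Summable fun n : ℤ => ‖a n‖ * (1 + |(n : ℝ)|) ^ β := by
    refine ha.congr fun n => ?_
    rw [Real.rpow_one, one_mul]
  have h0 := ha'.tendsto_cofinite_zero
  have h1 : ∀ᶠ n : ℤ in cofinite, ‖a n‖ * (1 + |(n : ℝ)|) ^ β < 1 := h0.eventually (gt_mem_nhds one_pos)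
  refine Summable.of_norm_bounded_eventually ha' ?_
  filter_upwards [h1] with n hn
  rw [Real.norm_of_nonneg (by positivity), mul_comm p β, Real.rpow_mul (by positivity), ← Real.mul_rpow (by positivity) (by positivity)]
  calc _ ≤ (‖a n‖ * (1 + |(n : ℝ)|) ^ β) ^ (1:ℝ) := Real.rpow_le_rpow_of_exponent_ge' (by positivity) hn.le (by norm_num) hp
    _ = _ := Real.rpow_one _

theorem memA_sub_one {β : ℝ} (a b : ℤ → ℂ) (ha : MemA 1 β a) (hb : MemA 1 β b) :
    MemA 1 β (fun n => a n - b n) := by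
  refine (ha.add hb).of_nonneg_of_le (fun n => by positivity) fun n => ?_
  rw [← add_mul]
  gcongr
  simp only [Real.rpow_one]
  exact norm_sub_le _ _

theorem memA_finite {p β : ℝ} (hp : 0 < p) (a : ℤ → ℂ) (ha : (Function.support a).Finite) :
    MemA p β a := by
  refine summable_of_hasFiniteSupport (ha.subset ?_)
  intro n hn h
  apply hn
  simp only [h]
  rw [norm_zero, Real.zero_rpow hp.ne', zero_mul]

/-- Fourier coefficients of the constant function `1`. -/
def dlt (n : ℤ) : ℂ := if n = 0 then 1 else 0

theorem dlt_supp : (Function.support dlt).Finite := by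
  refine (Set.finite_singleton (0:ℤ)).subset ?_
  intro n hn
  by_contra h
  exact hn (if_neg h)

theorem conv_dlt (a : ℤ → ℂ) : convSeq a dlt = a := by
  ext n
  unfold convSeq
  rw [tsum_eq_single n]
  · simp [dlt]
  · intro k hk
    have : n - k ≠ 0 := sub_ne_zero.2 hk.symm
    simp [dlt, this]

theorem dlt_conv (a : ℤ → ℂ) : convSeq dlt a = a := by
  ext n
  unfold convSeq
  rw [tsum_eq_single 0]
  · simp [dlt]
  · intro k hk
    simp [dlt, hk]

theorem conv_summable (a b : ℤ → ℂ) (ha : Summable fun n => ‖a n‖) (hb : Summable fun n => ‖b n‖)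
    (n : ℤ) : Summable fun k => a k * b (n - k) := by
  have h : Summable (fun x : ℤ × ℤ => a x.1 * b x.2) := summable_mul_of_summable_norm ha hb
  have hi : Function.Injective (fun k : ℤ => ((k, n - k) : ℤ × ℤ)) := fun x y h => (Prod.ext_iff.1 h).1
  have h3 := h.comp_injective hi
  exact h3

theorem fSum_hasSum (a : ℤ → ℂ) (ha : Summable fun n => ‖a n‖) (t : AddCircle (2 * Real.pi)) :
    Summable fun n => ‖a n * fourier n t‖ := by
  refine ha.congr fun n => ?_
  rw [norm_mul, fourier_apply, Circle.norm_coe, mul_one]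

theorem fSum_conv (a b : ℤ → ℂ) (ha : Summable fun n => ‖a n‖) (hb : Summable fun n => ‖b n‖)
    (t : AddCircle (2 * Real.pi)) : fSum (convSeq a b) t = fSum a t * fSum b t := by
  have hA := fSum_hasSum a ha t
  have hB := fSum_hasSum b hb t
  unfold fSum
  rw [tsum_mul_tsum_of_summable_norm hA hB]
  have hs := summable_mul_of_summable_norm hA hB
  let e : ℤ × ℤ ≃ ℤ × ℤ :=
    { toFun := fun x => (x.2, x.1 - x.2), invFun := fun x => (x.1 + x.2, x.1)
      left_inv := fun x => by ext <;> simp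
      right_inv := fun x => by ext <;> simp }
  rw [← e.tsum_eq]
  have hs' : Summable ((fun x : ℤ × ℤ => (a x.1 * fourier x.1 t) * (b x.2 * fourier x.2 t)) ∘ e) :=
    (e.summable_iff).2 hs
  refine Eq.trans ?_ (hs'.tsum_prod).symm
  congr 1; ext n
  unfold convSeq
  rw [← tsum_mul_right]
  congr 1; ext k
  simp only [e, Equiv.coe_fn_mk, Function.comp]
  have : (fourier n t : ℂ) = fourier k t * fourier (n - k) t := by
    rw [← fourier_add]; congr 2; ring
  rw [this]; ring

theorem fSum_continuous (a : ℤ → ℂ) (ha : Summable fun n => ‖a n‖) : Continuous (fSum a) := by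
  unfold fSum
  refine continuous_tsum (fun n => by fun_prop) ha fun n t => ?_
  rw [norm_mul, fourier_apply, Circle.norm_coe, mul_one]

theorem integral_fourier_ne (n : ℤ) (hn : n ≠ 0) :
    ∫ t : AddCircle (2 * Real.pi), fourier n t ∂AddCircle.haarAddCircle = 0 := by
  have h := congrFun (fourierCoeff_fourier (T := 2 * Real.pi) n) 0
  rw [Pi.single_apply, if_neg hn.symm] at h
  simpa [fourierCoeff] using h

theorem fSum_integral (a : ℤ → ℂ) (ha : Summable fun n => ‖a n‖) :
    ∫ t, fSum a t ∂AddCircle.haarAddCircle = a 0 := by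
  unfold fSum
  rw [← integral_tsum_of_summable_integral_norm]
  · rw [tsum_eq_single 0]
    · simp
    · intro n hn
      rw [integral_const_mul, integral_fourier_ne n hn, mul_zero]
  · intro n
    exact (Continuous.integrable_of_hasCompactSupport (by fun_prop) (HasCompactSupport.of_compactSpace _))
  · refine ha.congr fun n => ?_
    have : ∀ t : AddCircle (2 * Real.pi), ‖a n * fourier n t‖ = ‖a n‖ := fun t => by
      rw [norm_mul, fourier_apply, Circle.norm_coe, mul_one]
    simp only [this]
    simp

theorem conv_zero_bound (h g : ℤ → ℂ) (hh : Summable fun n => ‖h n‖) (hg : Summable fun n => ‖g n‖)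
    (hpos : ∀ t, ∃ r : ℝ, 0 ≤ r ∧ fSum g t = r) (ε : ℝ)
    (hε : ∀ t, fSum g t ≠ 0 → ‖fSum h t‖ ≤ ε) (hs : Summable fun n => ‖convSeq h g n‖) :
    ‖convSeq h g 0‖ ≤ ε * ‖g 0‖ := by
  rw [← fSum_integral _ hs]
  have hci : ∀ φ : AddCircle (2 * Real.pi) → ℝ, Continuous φ → Integrable φ AddCircle.haarAddCircle :=
    fun φ hφ => hφ.integrable_of_hasCompactSupport (HasCompactSupport.of_compactSpace _)
  have hc := fSum_continuous g hg
  have h1 : ∫ t, ‖fSum g t‖ ∂AddCircle.haarAddCircle = ‖g 0‖ := by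
    have h2 : ∀ t, fSum g t = ((‖fSum g t‖ : ℝ) : ℂ) := fun t => by
      obtain ⟨r, hr, e⟩ := hpos t
      rw [e]; simp [abs_of_nonneg hr]
    have h3 := fSum_integral g hg
    rw [integral_congr_ae (Filter.Eventually.of_forall h2), integral_complex_ofReal] at h3
    rw [← h3, Complex.norm_real, Real.norm_of_nonneg]
    exact integral_nonneg fun t => norm_nonneg _
  calc _ ≤ ∫ t, ‖fSum (convSeq h g) t‖ ∂AddCircle.haarAddCircle := norm_integral_le_integral_norm _
    _ ≤ ∫ t, ε * ‖fSum g t‖ ∂AddCircle.haarAddCircle := by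
      refine integral_mono (hci _ (fSum_continuous _ hs).norm) (hci _ (by fun_prop)) fun t => ?_
      simp only
      rw [fSum_conv h g hh hg, norm_mul]
      by_cases h0 : fSum g t = 0
      · simp [h0]
      · exact mul_le_mul_of_nonneg_right (hε t h0) (norm_nonneg _)
    _ = ε * ‖g 0‖ := by rw [integral_const_mul, h1]

theorem pairing_bound {p q : ℝ} (hpq : p.HolderConjugate q) (β : ℝ) (u g : ℤ → ℂ)
    (hu : MemA p β u) (hg : MemA q (-β) g) :
    ‖convSeq u g 0‖ ≤ normA p β u * normA q (-β) g := by
  have hp0 := hpq.pos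
  have hq0 := hpq.symm.pos
  have hg' : Summable fun n : ℤ => ‖g (-n)‖ ^ q * (1 + |(n : ℝ)|) ^ (q * -β) := by
    have := (Equiv.neg ℤ).summable_iff.2 hg
    refine this.congr fun n => ?_
    simp
  have hgs : ∑' n : ℤ, ‖g (-n)‖ ^ q * (1 + |(n : ℝ)|) ^ (q * -β) = wSum q (-β) g := by
    unfold wSum
    rw [← (Equiv.neg ℤ).tsum_eq]
    simp
  have e1 : ∀ n : ℤ, (‖u n‖ * (1 + |(n : ℝ)|) ^ β) ^ p = ‖u n‖ ^ p * (1 + |(n : ℝ)|) ^ (p * β) := fun n => by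
    rw [Real.mul_rpow (by positivity) (by positivity), ← Real.rpow_mul (by positivity), mul_comm β]
  have e2 : ∀ n : ℤ, (‖g (-n)‖ * (1 + |(n : ℝ)|) ^ (-β)) ^ q = ‖g (-n)‖ ^ q * (1 + |(n : ℝ)|) ^ (q * -β) := fun n => by
    rw [Real.mul_rpow (by positivity) (by positivity), ← Real.rpow_mul (by positivity), mul_comm (-β)]
  have key := Real.summable_and_inner_le_Lp_mul_Lq_tsum_of_nonneg hpq
    (f := fun n : ℤ => ‖u n‖ * (1 + |(n : ℝ)|) ^ β) (g := fun n : ℤ => ‖g (-n)‖ * (1 + |(n : ℝ)|) ^ (-β))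
    (fun n => by positivity) (fun n => by positivity) (hu.congr fun n => (e1 n).symm) (hg'.congr fun n => (e2 n).symm)
  simp_rw [e1, e2] at key
  rw [hgs] at key
  have e3 : ∀ n : ℤ, ‖u n‖ * (1 + |(n : ℝ)|) ^ β * (‖g (-n)‖ * (1 + |(n : ℝ)|) ^ (-β)) = ‖u n * g (0 - n)‖ := fun n => by
    have : (1 + |(n : ℝ)|) ^ β * (1 + |(n : ℝ)|) ^ (-β) = 1 := by
      rw [← Real.rpow_add (by positivity)]; simp
    rw [norm_mul, zero_sub]
    linear_combination ‖u n‖ * ‖g (-n)‖ * this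
  simp_rw [e3] at key
  exact (norm_tsum_le_tsum_norm key.1).trans key.2

theorem noncyclic {p q : ℝ} (hpq : p.HolderConjugate q) {β : ℝ} (hβ : 0 ≤ β)
    (E : Set (AddCircle (2 * Real.pi))) (C : ℝ) (g : ℕ → ℤ → ℂ)
    (hg1 : ∀ k, MemA 1 β (g k)) (hgq : ∀ k, MemA q (-β) (g k)) (hgC : ∀ k, normA q (-β) (g k) ≤ C)
    (hpos : ∀ k t, ∃ r : ℝ, 0 ≤ r ∧ fSum (g k) t = r)
    (h0 : ∀ k, 1 / 2 ≤ ‖g k 0‖) (h0' : ∀ k, ‖g k 0‖ ≤ 2)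
    (hsupp : ∀ U : Set (AddCircle (2 * Real.pi)), IsOpen U → E ⊆ U → ∃ k, ∀ t, t ∉ U → fSum (g k) t = 0)
    (c : ℤ → ℂ) (hc : MemA 1 β c) (hz : zeroSet c = E) : ¬ IsCyclicA p β c := by
  intro hcyc
  obtain ⟨a, ha, hlt⟩ := hcyc (1 / (8 * (|C| + 1))) (by positivity)
  have hA : MemA 1 β a := memA_finite one_pos a ha
  set h := convSeq a c with hh
  have hh1 : MemA 1 β h := memA_conv hβ a c hA hc
  have hhs := memA_summable hβ h hh1
  have hd : MemA 1 β dlt := memA_finite one_pos _ dlt_supp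
  have hu1 : MemA 1 β (fun n => dlt n - h n) := memA_sub_one _ _ hd hh1
  have hu := memA_of_one hpq.lt.le _ hu1
  obtain ⟨k, hk⟩ := hsupp {t | ‖fSum h t‖ < 1 / 8} (isOpen_lt (fSum_continuous h hhs).norm continuous_const) (by
    intro t ht
    rw [← hz] at ht
    have ht' : fSum c t = 0 := ht
    simp only [mem_ofPred_eq]
    rw [hh, fSum_conv a c (memA_summable hβ a hA) (memA_summable hβ c hc), ht']
    simp)
  have hgs := memA_summable hβ _ (hg1 k)
  have b1 := conv_zero_bound h (g k) hhs hgs (hpos k) (1/8) (by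
    intro t ht
    by_contra hcon
    refine ht (hk t ?_)
    simp only [mem_ofPred_eq]
    intro h3
    exact hcon h3.le) (memA_summable hβ _ (memA_conv hβ _ _ hh1 (hg1 k)))
  have b2 := pairing_bound hpq β _ (g k) hu (hgq k)
  have e : convSeq (fun n => dlt n - h n) (g k) 0 = g k 0 - convSeq h (g k) 0 := by
    conv_rhs => rw [← dlt_conv (g k)]
    rw [dlt_conv (g k)]
    conv_rhs => rw [← congrFun (dlt_conv (g k)) 0]
    unfold convSeq
    rw [← Summable.tsum_sub (conv_summable _ _ (memA_summable hβ _ hd) hgs 0) (conv_summable _ _ hhs hgs 0)]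
    congr 1; ext n; ring
  rw [e] at b2
  have b3 : normA p β (fun n => dlt n - h n) * normA q (-β) (g k) ≤ 1 / 8 := by
    have hlt' : normA p β (fun n => dlt n - h n) < 1 / (8 * (|C| + 1)) := hlt
    have hn : 0 ≤ normA q (-β) (g k) := Real.rpow_nonneg (wSum_nonneg _ _ _) _
    calc _ ≤ 1 / (8 * (|C| + 1)) * (|C| + 1) := by
          apply mul_le_mul hlt'.le _ hn (by positivity)
          linarith [hgC k, le_abs_self C]
      _ = 1 / 8 := by field_simp
  have b4 := norm_sub_norm_le (g k 0) (convSeq h (g k) 0)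
  have := h0 k
  have := h0' k
  linarith

/-- `e(x) = exp (2 π i x)` -/
def ee (x : ℝ) : ℂ := Complex.exp (2 * π * Complex.I * x)

theorem ee_add (x y : ℝ) : ee (x + y) = ee x * ee y := by
  unfold ee; rw [← Complex.exp_add]; push_cast; ring_nf

theorem ee_int (n : ℤ) : ee n = 1 := by
  unfold ee
  rw [Complex.exp_eq_one_iff]
  exact ⟨n, by push_cast; ring⟩

theorem hasSum_congr_both {f g : ℤ → ℂ} {a b : ℂ} (h : HasSum g b) (h1 : ∀ n, f n = g n) (h2 : a = b) :
    HasSum f a := by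
  rw [h2, show f = g from funext h1]; exact h

theorem bern_nonneg {x : ℝ} (h0 : 0 ≤ x) (h1 : x ≤ 1) :
    HasSum (fun n : ℤ => 1 / (n : ℂ) ^ 2 * ee (n * x)) ((2 * π ^ 2 * (x ^ 2 - x + 1 / 6) : ℝ) : ℂ) := by
  have h := hasSum_one_div_pow_mul_fourier_mul_bernoulliFun (le_refl 2) (x := x) ⟨h0, h1⟩
  have hb : bernoulliFun 2 x = x ^ 2 - x + 1 / 6 := by
    simp [bernoulliFun, Polynomial.bernoulli, Finset.sum_range_succ]
    ring
  rw [hb] at h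
  convert h using 1
  · ext n
    rw [fourier_coe_apply]
    unfold ee
    congr 2
    push_cast
    ring
  · push_cast
    have : Complex.I ^ 2 = -1 := Complex.I_sq
    simp only [mul_pow, this, Nat.factorial]
    push_cast
    ring

theorem bern {x : ℝ} (h1 : |x| ≤ 1) :
    HasSum (fun n : ℤ => 1 / (n : ℂ) ^ 2 * ee (n * x)) ((2 * π ^ 2 * (x ^ 2 - |x| + 1 / 6) : ℝ) : ℂ) := by
  rcases le_total 0 x with h | h
  · rw [abs_of_nonneg h] at h1 ⊢
    exact bern_nonneg h h1
  · rw [abs_of_nonpos h] at h1 ⊢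
    have := (Equiv.neg ℤ).hasSum_iff.2 (bern_nonneg (neg_nonneg.2 h) h1)
    convert this using 1
    · ext n
      simp
    · simp

theorem ee_two_cos (x : ℝ) : ee x + ee (-x) - 2 = ((-4 * Real.sin (π * x) ^ 2 : ℝ) : ℂ) := by
  have h1 : ee x + ee (-x) = 2 * Complex.cos (2 * (π * x)) := by
    rw [Complex.two_cos]
    unfold ee
    congr 2
    · ring
    · push_cast; ring
  rw [h1, Complex.cos_two_mul, Complex.cos_sq']
  push_cast
  ring

theorem tri {η y : ℝ} (h0 : 0 < η) (h1 : η ≤ 1 / 2) (hy : |y| ≤ 1 / 2) :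
    HasSum (fun n : ℤ => ((Real.sinc (π * n * η) ^ 2 : ℝ) : ℂ) * ee (n * y))
      (((|y + η| + |y - η| - 2 * |y|) / (2 * η ^ 2) : ℝ) : ℂ) := by
  have hη : |η| ≤ 1 / 2 := by rwa [abs_of_pos h0]
  have A := bern (x := y + η) ((abs_add_le _ _).trans (by linarith))
  have B := bern (x := y - η) ((abs_sub _ _).trans (by linarith))
  have C := bern (x := y) (by linarith)
  have D : HasSum (fun n : ℤ => if n = 0 then (1:ℂ) else 0) 1 := hasSum_ite_eq 0 1
  have hπ : (π : ℂ) ≠ 0 := by exact_mod_cast Real.pi_ne_zero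
  have hηC : (η : ℂ) ≠ 0 := by exact_mod_cast h0.ne'
  have key := D.sub (((A.add B).sub (C.mul_left 2)).mul_left (1 / (4 * (π : ℂ) ^ 2 * η ^ 2)))
  refine hasSum_congr_both key ?_ ?_
  · intro n
    rcases eq_or_ne n 0 with rfl | hn
    · simp [ee]
    · have hnC : (n : ℂ) ≠ 0 := by exact_mod_cast hn
      have hnR : (n : ℝ) ≠ 0 := by exact_mod_cast hn
      have hne : π * n * η ≠ 0 := mul_ne_zero (mul_ne_zero Real.pi_ne_zero hnR) h0.ne'
      rw [if_neg hn, Real.sinc_of_ne_zero hne]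
      have e1 : ee (n * (y + η)) = ee (n * y) * ee (n * η) := by rw [← ee_add]; ring_nf
      have e2 : ee (n * (y - η)) = ee (n * y) * ee (-(n * η)) := by rw [← ee_add]; ring_nf
      have e3 := ee_two_cos (n * η)
      rw [e1, e2]
      have e4 : 1 / (n : ℂ) ^ 2 * (ee (n * y) * ee (n * η)) + 1 / (n : ℂ) ^ 2 * (ee (n * y) * ee (-(n * η)))
        - 2 * (1 / (n : ℂ) ^ 2 * ee (n * y)) = 1 / (n : ℂ) ^ 2 * ee (n * y) * (ee (n * η) + ee (-(n * η)) - 2) := by ring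
      rw [e4, e3, ← mul_assoc π]
      push_cast
      field_simp
      ring
  · have hπR := Real.pi_ne_zero
    have : ((|y + η| + |y - η| - 2 * |y|) / (2 * η ^ 2) : ℝ) = 1 - 1 / (4 * π ^ 2 * η ^ 2) *
      (2 * π ^ 2 * ((y + η) ^ 2 - |y + η| + 1 / 6) + 2 * π ^ 2 * ((y - η) ^ 2 - |y - η| + 1 / 6)
        - 2 * (2 * π ^ 2 * (y ^ 2 - |y| + 1 / 6))) := by
      field_simp
      ring
    rw [this]
    push_cast
    ring

/-- value of the triangle kernel -/
def triV (η y : ℝ) : ℝ :=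
  (|y - round y + η| + |y - round y - η| - 2 * |y - round y|) / (2 * η ^ 2)

theorem triV_nonneg (η y : ℝ) : 0 ≤ triV η y := by
  unfold triV
  apply div_nonneg _ (by positivity)
  set z := y - round y
  have := abs_add_le (z + η) (z - η)
  have e : |z + η + (z - η)| = 2 * |z| := by
    rw [show z + η + (z - η) = 2 * z by ring, abs_mul]; norm_num
  linarith

theorem triV_zero (η y : ℝ) (h0 : 0 < η) (h : η ≤ |y - round y|) : triV η y = 0 := by
  unfold triV
  set z := y - round y
  have : |z + η| + |z - η| - 2 * |z| = 0 := by
    rcases abs_cases z with ⟨h1, h2⟩ | ⟨h1, h2⟩ <;> rcases abs_cases (z + η) with ⟨h3, h4⟩ | ⟨h3, h4⟩ <;>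
    rcases abs_cases (z - η) with ⟨h5, h6⟩ | ⟨h5, h6⟩ <;> linarith
  rw [this, zero_div]

theorem tri' {η : ℝ} (y : ℝ) (h0 : 0 < η) (h1 : η ≤ 1 / 2) :
    HasSum (fun n : ℤ => ((Real.sinc (π * n * η) ^ 2 : ℝ) : ℂ) * ee (n * y)) (triV η y : ℂ) := by
  have h := tri h0 h1 (abs_sub_round y)
  refine hasSum_congr_both h (fun n => ?_) rfl
  have : ee (n * y) = ee (n * (y - round y)) := by
    have e : (n : ℝ) * y = n * (y - round y) + ((n * round y : ℤ) : ℝ) := by push_cast; ring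
    rw [e, ee_add, ee_int, mul_one]
  rw [this]

theorem kern {m : ℕ} (hm : 0 < m) {δ : ℝ} (h0 : 0 < δ) (h1 : m * δ ≤ 1 / 2) (x : ℝ) :
    HasSum (fun n : ℤ => if (m : ℤ) ∣ n then ((Real.sinc (π * n * δ) ^ 2 : ℝ) : ℂ) * ee (n * x) else 0)
      (triV (m * δ) (m * x) : ℂ) := by
  have hm' : (m : ℤ) ≠ 0 := by exact_mod_cast hm.ne'
  have h := tri' (m * x) (η := m * δ) (by positivity) h1
  have hi : Function.Injective (fun j : ℤ => (m : ℤ) * j) := mul_right_injective₀ hm'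
  rw [← hi.hasSum_iff]
  · convert h using 1
    ext j
    simp only [Function.comp, dvd_mul_right, if_true]
    congr 2
    · push_cast; ring_nf
    · push_cast; ring_nf
  · intro n hn
    rw [if_neg]
    rintro ⟨j, rfl⟩
    exact hn ⟨j, rfl⟩

/-- Fourier coefficients of the building block. -/
def bX (X : ℕ) (δ : ℝ) (n : ℤ) : ℂ :=
  (((Nat.primesLE X).card : ℝ)⁻¹ * (((Nat.primesLE X).filter fun m : ℕ => (m : ℤ) ∣ n).card : ℝ) * Real.sinc (π * n * δ) ^ 2 : ℝ)

theorem bX_zero (X : ℕ) (hX : 2 ≤ X) (δ : ℝ) : bX X δ 0 = 1 := by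
  unfold bX
  have h : (Nat.primesLE X).card ≠ 0 := by
    rw [Finset.card_ne_zero]
    exact ⟨2, by simp [Nat.mem_primesLE, hX, Nat.prime_two]⟩
  have h' : ((Nat.primesLE X).card : ℝ) ≠ 0 := by exact_mod_cast h
  simp only [dvd_zero, Finset.filter_true, Int.cast_zero, mul_zero, zero_mul, Real.sinc_zero]
  rw [inv_mul_cancel₀ h']
  simp

theorem fSum_bX (X : ℕ) {δ : ℝ} (h0 : 0 < δ) (h1 : X * δ ≤ 1 / 2) (t : ℝ) :
    fSum (bX X δ) (t : AddCircle (2 * Real.pi)) =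
      (((Nat.primesLE X).card : ℝ)⁻¹ * ∑ m ∈ Nat.primesLE X, triV (m * δ) (m * (t / (2 * π))) : ℝ) := by
  have h := hasSum_sum (s := Nat.primesLE X) (fun m hm => kern (m := m) (Nat.mem_primesLE.1 hm).2.pos h0 (by
    have : (m : ℝ) ≤ X := by exact_mod_cast (Nat.mem_primesLE.1 hm).1
    nlinarith) (t / (2 * π)))
  have h2 := h.mul_left ((((Nat.primesLE X).card : ℝ)⁻¹ : ℝ) : ℂ)
  unfold fSum
  have h3 := h2.tsum_eq
  push_cast at h3 ⊢
  rw [← h3]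
  congr 1; ext n
  have hf : (fourier n (t : AddCircle (2 * Real.pi)) : ℂ) = ee (n * (t / (2 * π))) := by
    rw [fourier_coe_apply]
    unfold ee
    push_cast
    congr 1
    ring
  rw [hf, ← Finset.sum_filter, Finset.sum_const]
  unfold bX
  push_cast
  rw [nsmul_eq_mul]
  ring

theorem bX_pos (X : ℕ) {δ : ℝ} (h0 : 0 < δ) (h1 : X * δ ≤ 1 / 2) (t : AddCircle (2 * Real.pi)) :
    ∃ r : ℝ, 0 ≤ r ∧ fSum (bX X δ) t = r := by
  obtain ⟨t, rfl⟩ := QuotientAddGroup.mk_surjective t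
  refine ⟨_, ?_, fSum_bX X h0 h1 t⟩
  exact mul_nonneg (by positivity) (Finset.sum_nonneg fun m _ => triV_nonneg _ _)

/-- centers -/
def ctr (m k : ℕ) : AddCircle (2 * Real.pi) := ((2 * π * k / m : ℝ) : AddCircle (2 * Real.pi))

/-- supporting set of the building block -/
def KX (X : ℕ) (δ : ℝ) : Set (AddCircle (2 * Real.pi)) :=
  ⋃ i ∈ (Finset.range (X + 1) ×ˢ Finset.range (X + 1)), Metric.closedBall (ctr i.1 i.2) (2 * π * δ)

theorem KX_closed (X : ℕ) (δ : ℝ) : IsClosed (KX X δ) :=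
  isClosed_biUnion_finset fun _ _ => Metric.isClosed_closedBall

theorem bX_supp (X : ℕ) {δ : ℝ} (h0 : 0 < δ) (h1 : X * δ ≤ 1 / 2) (t : AddCircle (2 * Real.pi))
    (ht : t ∉ KX X δ) : fSum (bX X δ) t = 0 := by
  obtain ⟨t, rfl⟩ := QuotientAddGroup.mk_surjective t
  have e := fSum_bX X h0 h1 t
  refine e.trans ?_
  rw [Finset.sum_eq_zero, mul_zero, Complex.ofReal_zero]
  intro m hm
  have hmp := (Nat.mem_primesLE.1 hm).2.pos
  have hmX := (Nat.mem_primesLE.1 hm).1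
  have hmR : (0:ℝ) < m := by exact_mod_cast hmp
  apply triV_zero _ _ (by positivity)
  by_contra hcon
  push Not at hcon
  apply ht
  set j := round ((m : ℝ) * (t / (2 * π))) with hj
  obtain ⟨k, hk⟩ : ∃ k : ℕ, (k : ℤ) = j % m := ⟨(j % m).toNat, Int.toNat_of_nonneg (Int.emod_nonneg _ (by exact_mod_cast hmp.ne'))⟩
  have hkm : k < m := by
    have := Int.emod_lt_of_pos j (show (0:ℤ) < m by exact_mod_cast hmp)
    omega
  have hjk : (j : ℝ) = k + m * ((j / m : ℤ) : ℝ) := by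
    have := Int.emod_add_mul_ediv j m
    rw [← hk] at this
    exact_mod_cast this.symm
  have hc : ctr m k = ((2 * π * j / m : ℝ) : AddCircle (2 * Real.pi)) := by
    unfold ctr
    rw [← sub_eq_zero, ← AddCircle.coe_sub, AddCircle.coe_eq_zero_iff]
    refine ⟨-(j / m), ?_⟩
    rw [hjk]
    simp only [zsmul_eq_mul, Int.cast_neg]
    field_simp
    ring
  refine mem_biUnion (x := (m, k)) (by simp; omega) ?_
  rw [Metric.mem_closedBall, hc, dist_eq_norm]
  have e2 : ((t : ℝ) : AddCircle (2 * Real.pi)) - ((2 * π * j / m : ℝ) : AddCircle (2 * Real.pi)) =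
    ((t - 2 * π * j / m : ℝ) : AddCircle (2 * Real.pi)) := rfl
  refine (le_of_eq (congrArg norm e2)).trans ?_
  refine (QuotientAddGroup.norm_mk_le_norm).trans ?_
  rw [Real.norm_eq_abs]
  have e3 : t - 2 * π * j / m = (2 * π / m) * (m * (t / (2 * π)) - j) := by
    field_simp
  rw [e3, abs_mul, abs_of_pos (by positivity)]
  calc _ ≤ 2 * π / m * (m * δ) := by gcongr
    _ = _ := by field_simp

theorem abs_sinc_le_inv {y : ℝ} (hy : y ≠ 0) : |Real.sinc y| ≤ |y|⁻¹ := by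
  rw [Real.sinc_of_ne_zero hy, abs_div, div_eq_mul_inv]
  have := Real.abs_sin_le_one y
  have h : 0 < |y|⁻¹ := by positivity
  nlinarith

theorem sinc_sq_le {y s : ℝ} (hy : y ≠ 0) (hs0 : 0 ≤ s) (hs2 : s ≤ 2) :
    Real.sinc y ^ 2 ≤ |y| ^ (-s) := by
  have hy' : 0 < |y| := abs_pos.2 hy
  rw [← sq_abs]
  rcases le_total 1 |y| with h | h
  · calc |Real.sinc y| ^ 2 ≤ (|y|⁻¹) ^ 2 := by
          gcongr; exact abs_sinc_le_inv hy
      _ = |y| ^ (-2 : ℝ) := by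
          rw [Real.rpow_neg hy'.le, inv_pow]; norm_num
      _ ≤ |y| ^ (-s) := Real.rpow_le_rpow_of_exponent_le h (by linarith)
  · calc |Real.sinc y| ^ 2 ≤ 1 ^ 2 := by gcongr; exact Real.abs_sinc_le_one y
      _ = 1 := by norm_num
      _ ≤ _ := Real.one_le_rpow_of_pos_of_le_one_of_nonpos hy' h (by linarith)

theorem sinc_bd {δ s : ℝ} (hδ : 0 < δ) (hs0 : 0 ≤ s) (hs2 : s ≤ 2) (n : ℤ) (hn : n ≠ 0) :
    Real.sinc (π * n * δ) ^ 2 ≤ δ ^ (-s) * |(n : ℝ)| ^ (-s) := by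
  have hnR : (n : ℝ) ≠ 0 := by exact_mod_cast hn
  have hn' : 0 < |(n : ℝ)| := abs_pos.2 hnR
  have hne : π * n * δ ≠ 0 := mul_ne_zero (mul_ne_zero Real.pi_ne_zero hnR) hδ.ne'
  refine (sinc_sq_le hne hs0 hs2).trans ?_
  rw [← Real.mul_rpow hδ.le hn'.le, abs_mul, abs_mul, abs_of_pos Real.pi_pos, abs_of_pos hδ]
  apply Real.rpow_le_rpow_of_nonpos (by positivity) _ (by linarith)
  have : 1 ≤ π := by linarith [Real.pi_gt_three]
  have h2 : 0 < δ * |(n : ℝ)| := by positivity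
  nlinarith

theorem card_dvd_le (X : ℕ) (n : ℤ) (hn : n ≠ 0) {ε : ℝ} (hε : 0 < ε) :
    (((Nat.primesLE X).filter fun m : ℕ => (m : ℤ) ∣ n).card : ℝ) ≤ (ε * Real.log 2)⁻¹ * |(n : ℝ)| ^ ε := by
  set S := (Nat.primesLE X).filter fun m : ℕ => (m : ℤ) ∣ n
  have hnn : n.natAbs ≠ 0 := Int.natAbs_ne_zero.2 hn
  have h1 : S ⊆ n.natAbs.primeFactors := by
    intro m hm
    rw [Finset.mem_filter] at hm
    rw [Nat.mem_primeFactors]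
    exact ⟨(Nat.mem_primesLE.1 hm.1).2, Int.natCast_dvd.1 hm.2, hnn⟩
  have h2 : 2 ^ S.card ≤ n.natAbs := by
    calc 2 ^ S.card ≤ ∏ m ∈ S, m := Finset.pow_card_le_prod _ _ _ (fun m hm =>
          (Nat.mem_primesLE.1 (Finset.mem_filter.1 hm).1).2.two_le)
      _ ≤ n.natAbs := Nat.le_of_dvd (Nat.pos_of_ne_zero hnn)
          ((Finset.prod_dvd_prod_of_subset _ _ _ h1).trans (Nat.prod_primeFactors_dvd _))
  have h3 : (2:ℝ) ^ S.card ≤ |(n : ℝ)| := by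
    rw [← Int.cast_abs, ← Nat.cast_natAbs]; exact_mod_cast h2
  have h4 : S.card * Real.log 2 ≤ Real.log |(n : ℝ)| := by
    rw [← Real.log_pow]
    exact Real.log_le_log (by positivity) h3
  have h5 := Real.log_le_rpow_div (abs_nonneg (n : ℝ)) hε
  have hl : 0 < Real.log 2 := Real.log_pos (by norm_num)
  rw [← div_eq_inv_mul, le_div_iff₀ (by positivity)]
  rw [le_div_iff₀ hε] at h5
  nlinarith

theorem norm_bX (X : ℕ) (δ : ℝ) (n : ℤ) : ‖bX X δ n‖ =
    ((Nat.primesLE X).card : ℝ)⁻¹ * (((Nat.primesLE X).filter fun m : ℕ => (m : ℤ) ∣ n).card : ℝ) * Real.sinc (π * n * δ) ^ 2 := by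
  unfold bX
  rw [Complex.norm_real, Real.norm_of_nonneg (by positivity)]

theorem memA_bX (X : ℕ) {δ β : ℝ} (hδ : 0 < δ) (hβ0 : 0 ≤ β) (hβ : β < 1) : MemA 1 β (bX X δ) := by
  have hs := (Real.summable_abs_int_rpow (b := 2 - β) (by linarith)).mul_left (δ ^ (-2 : ℝ) * 2)
  refine Summable.of_norm_bounded_eventually hs ?_
  filter_upwards [(Set.finite_singleton (0:ℤ)).compl_mem_cofinite] with n hn
  have hn0 : n ≠ 0 := hn
  have hnR : (n : ℝ) ≠ 0 := by exact_mod_cast hn0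
  have hn' : 0 < |(n : ℝ)| := abs_pos.2 hnR
  have hn1 : 1 ≤ |(n : ℝ)| := by
    rw [← Int.cast_abs]; exact_mod_cast Int.one_le_abs hn0
  rw [Real.norm_of_nonneg (by positivity), Real.rpow_one, one_mul, norm_bX]
  have b1 : ((Nat.primesLE X).card : ℝ)⁻¹ * (((Nat.primesLE X).filter fun m : ℕ => (m : ℤ) ∣ n).card : ℝ) ≤ 1 := by
    rw [← div_eq_inv_mul]
    apply div_le_one_of_le₀ _ (by positivity)
    exact_mod_cast Finset.card_filter_le _ _
  have b2 : (1 + |(n : ℝ)|) ^ β ≤ 2 * |(n : ℝ)| ^ β := by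
    calc (1 + |(n : ℝ)|) ^ β ≤ (2 * |(n : ℝ)|) ^ β := by gcongr; linarith
      _ = 2 ^ β * |(n : ℝ)| ^ β := Real.mul_rpow (by norm_num) hn'.le
      _ ≤ 2 * |(n : ℝ)| ^ β := by
        gcongr
        calc (2:ℝ) ^ β ≤ 2 ^ (1:ℝ) := Real.rpow_le_rpow_of_exponent_le (by norm_num) hβ.le
          _ = 2 := Real.rpow_one _
  calc _ ≤ 1 * (δ ^ (-2:ℝ) * |(n : ℝ)| ^ (-2:ℝ)) * (2 * |(n : ℝ)| ^ β) := by
        gcongr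
        exact sinc_bd hδ (by norm_num) le_rfl n hn0
    _ = δ ^ (-2:ℝ) * 2 * (|(n : ℝ)| ^ (-2:ℝ) * |(n : ℝ)| ^ β) := by ring
    _ = _ := by rw [← Real.rpow_add hn']; congr 2; ring

theorem bX_small {q β α : ℝ} (hq : 1 ≤ q) (hβ : 0 ≤ β) (hβq : β * q ≤ 1)
    (hα1 : (2 / q) * (1 - β * q) < α) (hα2 : α ≤ 1) (η : ℝ) (hη : 0 < η) :
    ∀ᶠ X : ℕ in atTop, MemA q (-β) (fun n => bX X ((X : ℝ) ^ (-2 / α)) n - dlt n) ∧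
      wSum q (-β) (fun n => bX X ((X : ℝ) ^ (-2 / α)) n - dlt n) ≤ η := by
  have hq0 : 0 < q := by linarith
  have hα0 : 0 < α := lt_of_le_of_lt (by
    apply mul_nonneg (by positivity); linarith) hα1
  have hu : 0 ≤ 1 / q - β := by
    rw [sub_nonneg, le_div_iff₀ hq0]; exact hβq
  have hu2 : 1 / q - β < α / 2 := by
    have e : (2 / q) * (1 - β * q) = 2 * (1 / q - β) := by field_simp
    linarith
  obtain ⟨ε, hε, hεα⟩ : ∃ ε : ℝ, 0 < ε ∧ 1 / q - β + 2 * ε < α / 2 :=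
    ⟨(α / 2 - (1 / q - β)) / 4, by linarith, by linarith⟩
  set s := 1 / q - β + 2 * ε with hs
  have hs0 : 0 ≤ s := by linarith
  have hs2 : s ≤ 2 := by linarith
  set θ := 2 * s / α with hθ
  have hθ1 : θ < 1 := by rw [hθ, div_lt_one hα0]; linarith
  set κ := (1 - θ) / 2 with hκ
  have hκ0 : 0 < κ := by linarith
  set S := ∑' n : ℤ, |(n : ℝ)| ^ (-(1 + ε * q)) with hS
  have hSs : Summable fun n : ℤ => |(n : ℝ)| ^ (-(1 + ε * q)) := Real.summable_abs_int_rpow (by nlinarith)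
  have hS0 : 0 ≤ S := tsum_nonneg fun n => by positivity
  set C := (ε * Real.log 2)⁻¹ with hC
  have hC0 : 0 < C := inv_pos.2 (mul_pos hε (Real.log_pos (by norm_num)))
  -- the limit
  have hlim : Tendsto (fun X : ℕ => (C * (4 / κ) * (X : ℝ) ^ (-κ)) ^ q * S) atTop (𝓝 0) := by
    have h1 : Tendsto (fun X : ℕ => (X : ℝ) ^ (-κ)) atTop (𝓝 0) :=
      (tendsto_rpow_neg_atTop hκ0).comp tendsto_natCast_atTop_atTop
    have h2 := (((h1.const_mul (C * (4 / κ))).rpow_const (p := q) (Or.inr hq0.le)).mul_const S)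
    simpa [Real.zero_rpow hq0.ne'] using h2
  filter_upwards [eventually_ge_atTop 4, hlim.eventually (gt_mem_nhds hη)] with X hX hXη
  have hXR : (4:ℝ) ≤ X := by exact_mod_cast hX
  have hX0 : (0:ℝ) < X := by linarith
  set δ := (X : ℝ) ^ (-2 / α) with hδ
  have hδ0 : 0 < δ := by positivity
  have hδs : δ ^ (-s) = (X : ℝ) ^ θ := by
    rw [hδ, ← Real.rpow_mul hX0.le]; congr 1; rw [hθ]; field_simp
  -- prime counting
  have hpi : ((Nat.primesLE X).card : ℝ)⁻¹ * (X : ℝ) ^ θ ≤ (4 / κ) * (X : ℝ) ^ (-κ) := by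
    have h1 := Chebyshev.pi_ge X
    rw [← Nat.primesLE_card_eq_primeCounting] at h1
    have hlog : 0 < Real.log X := Real.log_pos (by linarith)
    have h2 : (X : ℝ) / 4 ≤ X * Real.log 2 - Real.log (X + 1) := by
      have e : Real.log (X + 1) = Real.log ((X + 1) / 4) + 2 * Real.log 2 := by
        rw [Real.log_div (by positivity) (by norm_num), show (4:ℝ) = 2 ^ 2 by norm_num, Real.log_pow]
        push_cast; ring
      have e2 := Real.log_le_sub_one_of_pos (show (0:ℝ) < (X + 1) / 4 by positivity)
      have := Real.log_two_gt_d9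
      have := Real.log_two_lt_d9
      rw [e]
      nlinarith
    have h3 : Real.log X ≤ X ^ κ / κ := Real.log_le_rpow_div hX0.le hκ0
    have h4 : κ / 4 * (X : ℝ) ^ (1 - κ) ≤ (Nat.primesLE X).card := by
      refine le_trans ?_ h1
      rw [le_div_iff₀ hlog]
      refine le_trans ?_ h2
      calc _ ≤ κ / 4 * (X : ℝ) ^ (1 - κ) * (X ^ κ / κ) := by gcongr
        _ = 1 / 4 * ((X : ℝ) ^ (1 - κ) * X ^ κ) := by field_simp
        _ = _ := by rw [← Real.rpow_add hX0]; simp; ring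
    have h5 : 0 < κ / 4 * (X : ℝ) ^ (1 - κ) := by positivity
    calc _ ≤ (κ / 4 * (X : ℝ) ^ (1 - κ))⁻¹ * (X : ℝ) ^ θ := by gcongr
      _ = (4 / κ) * ((X : ℝ) ^ (-(1 - κ)) * (X : ℝ) ^ θ) := by
        rw [mul_inv, inv_div, Real.rpow_neg hX0.le]; ring
      _ = _ := by
        rw [← Real.rpow_add hX0]; congr 2; rw [hκ]; ring
  set B := C * (4 / κ) * (X : ℝ) ^ (-κ) with hB
  have hB0 : 0 < B := by positivity
  have hterm : ∀ n : ℤ, ‖bX X δ n - dlt n‖ ^ q * (1 + |(n : ℝ)|) ^ (q * -β) ≤ B ^ q * |(n : ℝ)| ^ (-(1 + ε * q)) := by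
    intro n
    rcases eq_or_ne n 0 with rfl | hn
    · have e : bX X δ 0 - dlt 0 = 0 := by rw [bX_zero X (by omega)]; simp [dlt]
      rw [e, norm_zero, Real.zero_rpow hq0.ne', zero_mul]
      positivity
    · have e : bX X δ n - dlt n = bX X δ n := by simp [dlt, hn]
      have hnR : (n : ℝ) ≠ 0 := by exact_mod_cast hn
      have hn' : 0 < |(n : ℝ)| := abs_pos.2 hnR
      have b1 : ‖bX X δ n‖ ≤ B * |(n : ℝ)| ^ (ε - s) := by
        rw [norm_bX]
        calc _ ≤ ((Nat.primesLE X).card : ℝ)⁻¹ * (C * |(n : ℝ)| ^ ε) * (δ ^ (-s) * |(n : ℝ)| ^ (-s)) := by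
              gcongr
              · exact card_dvd_le X n hn hε
              · exact sinc_bd hδ0 hs0 hs2 n hn
          _ = C * (((Nat.primesLE X).card : ℝ)⁻¹ * (X : ℝ) ^ θ) * (|(n : ℝ)| ^ ε * |(n : ℝ)| ^ (-s)) := by
              rw [hδs]; ring
          _ ≤ C * ((4 / κ) * (X : ℝ) ^ (-κ)) * (|(n : ℝ)| ^ ε * |(n : ℝ)| ^ (-s)) := by gcongr
          _ = _ := by rw [← Real.rpow_add hn', hB, ← sub_eq_add_neg]; ring
      rw [e]
      calc _ ≤ (B * |(n : ℝ)| ^ (ε - s)) ^ q * |(n : ℝ)| ^ (q * -β) := by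
            apply mul_le_mul _ _ (by positivity) (by positivity)
            · exact Real.rpow_le_rpow (norm_nonneg _) b1 hq0.le
            · apply Real.rpow_le_rpow_of_nonpos hn' (by linarith)
              nlinarith
        _ = B ^ q * (|(n : ℝ)| ^ ((ε - s) * q) * |(n : ℝ)| ^ (q * -β)) := by
            rw [Real.mul_rpow hB0.le (by positivity), ← Real.rpow_mul hn'.le]; ring
        _ = _ := by
            rw [← Real.rpow_add hn']; congr 2; rw [hs]; field_simp; ring
  have hsum := hSs.mul_left (B ^ q)
  have hmem : MemA q (-β) (fun n => bX X δ n - dlt n) :=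
    hsum.of_nonneg_of_le (fun n => by positivity) hterm
  refine ⟨hmem, ?_⟩
  calc wSum q (-β) (fun n => bX X δ n - dlt n) ≤ ∑' n : ℤ, B ^ q * |(n : ℝ)| ^ (-(1 + ε * q)) :=
        Summable.tsum_le_tsum hterm hmem hsum
    _ = B ^ q * S := tsum_mul_left
    _ ≤ η := hXη.le

theorem wt_rpow (q γ : ℝ) (c : ℤ → ℂ) (n : ℤ) :
    (‖c n‖ * (1 + |(n : ℝ)|) ^ γ) ^ q = ‖c n‖ ^ q * (1 + |(n : ℝ)|) ^ (q * γ) := by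
  rw [Real.mul_rpow (norm_nonneg _) (by positivity), ← Real.rpow_mul (by positivity), mul_comm γ q]

theorem normA_add {q : ℝ} (hq : 1 ≤ q) (γ : ℝ) (a b : ℤ → ℂ) (ha : MemA q γ a) (hb : MemA q γ b) :
    MemA q γ (fun n => a n + b n) ∧
      normA q γ (fun n => a n + b n) ≤ normA q γ a + normA q γ b := by
  have ha' : Summable fun n : ℤ => (‖a n‖ * (1 + |(n : ℝ)|) ^ γ) ^ q := by
    simpa only [wt_rpow, MemA] using ha
  have hb' : Summable fun n : ℤ => (‖b n‖ * (1 + |(n : ℝ)|) ^ γ) ^ q := by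
    simpa only [wt_rpow, MemA] using hb
  have key := Real.Lp_add_le_tsum_of_nonneg hq (f := fun n : ℤ => ‖a n‖ * (1 + |(n : ℝ)|) ^ γ)
    (g := fun n : ℤ => ‖b n‖ * (1 + |(n : ℝ)|) ^ γ) (fun n => by positivity)
    (fun n => by positivity) ha' hb'
  have hle : ∀ n : ℤ, ‖a n + b n‖ ^ q * (1 + |(n : ℝ)|) ^ (q * γ) ≤
      (‖a n‖ * (1 + |(n : ℝ)|) ^ γ + ‖b n‖ * (1 + |(n : ℝ)|) ^ γ) ^ q := by
    intro n
    rw [← wt_rpow q γ (fun n => a n + b n) n, ← add_mul]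
    apply Real.rpow_le_rpow (by positivity) _ (by linarith)
    exact mul_le_mul_of_nonneg_right (norm_add_le _ _) (by positivity)
  have hs : MemA q γ (fun n => a n + b n) :=
    Summable.of_nonneg_of_le (fun n => by positivity) hle key.1
  refine ⟨hs, ?_⟩
  unfold normA wSum
  simp only [wt_rpow] at key
  refine le_trans ?_ key.2
  apply Real.rpow_le_rpow (tsum_nonneg fun n => by positivity) _ (by positivity)
  exact hs.tsum_le_tsum hle (by simpa only [wt_rpow] using key.1)

theorem norm_zero_le_normA {q : ℝ} (hq : 1 ≤ q) (γ : ℝ) (a : ℤ → ℂ) (ha : MemA q γ a) :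
    ‖a 0‖ ≤ normA q γ a := by
  have h := ha.le_tsum 0 (fun n _ => by positivity)
  have h2 : ‖a 0‖ ^ q ≤ wSum q γ a := by
    simpa [wSum] using h
  unfold normA
  calc ‖a 0‖ = (‖a 0‖ ^ q) ^ (1 / q) := by
        rw [← Real.rpow_mul (norm_nonneg _), mul_one_div_cancel (by linarith), Real.rpow_one]
    _ ≤ _ := Real.rpow_le_rpow (by positivity) h2 (by positivity)

theorem normA_dlt {q : ℝ} (hq : 1 ≤ q) (γ : ℝ) : normA q γ dlt = 1 := by
  unfold normA wSum
  rw [tsum_eq_single 0]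
  · simp [dlt]
  · intro n hn
    simp [dlt, hn, Real.zero_rpow (show q ≠ 0 by linarith)]

/-- invariants of the construction -/
def Good (q β : ℝ) (k : ℕ) (g : ℤ → ℂ) : Prop :=
  MemA 1 β g ∧ MemA q (-β) g ∧ normA q (-β) g ≤ 2 - (1 / 2) ^ k ∧
    ‖g 0 - 1‖ ≤ 1 / 2 - (1 / 2) ^ (k + 1) ∧
    ∀ t, ∃ r : ℝ, 0 ≤ r ∧ fSum g t = r

theorem good_zero {q β : ℝ} (hq : 1 ≤ q) : Good q β 0 dlt := by
  refine ⟨memA_finite (by norm_num) _ dlt_supp, memA_finite (by linarith) _ dlt_supp, ?_, ?_, ?_⟩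
  · rw [normA_dlt hq]; norm_num
  · simp [dlt]
  · intro t
    refine ⟨1, zero_le_one, ?_⟩
    unfold fSum
    rw [tsum_eq_single 0]
    · simp [dlt]
    · intro n hn; simp [dlt, hn]

theorem delta_bound {α : ℝ} (hα0 : 0 < α) (hα2 : α ≤ 1) {X : ℕ} (hX : 2 ≤ X) :
    0 < (X : ℝ) ^ (-2 / α) ∧ (X : ℝ) * (X : ℝ) ^ (-2 / α) ≤ 1 / 2 := by
  have hX0 : (2 : ℝ) ≤ X := by exact_mod_cast hX
  refine ⟨by positivity, ?_⟩
  have h1 : (X : ℝ) ^ (-2 / α) ≤ (X : ℝ) ^ (-2 : ℝ) := by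
    apply Real.rpow_le_rpow_of_exponent_le (by linarith)
    rw [div_le_iff₀ hα0]; linarith
  have h2 : (X : ℝ) ^ (-2 : ℝ) = ((X : ℝ) ^ 2)⁻¹ := by
    rw [Real.rpow_neg (by positivity)]; norm_cast
  calc (X : ℝ) * (X : ℝ) ^ (-2 / α) ≤ X * ((X : ℝ) ^ 2)⁻¹ := by
        rw [← h2]; exact mul_le_mul_of_nonneg_left h1 (by positivity)
    _ = 1 / X := by field_simp
    _ ≤ 1 / 2 := one_div_le_one_div_of_le (by norm_num) hX0

theorem good_step {q β α : ℝ} (hq : 1 ≤ q) (hβ : 0 ≤ β) (hβ1 : β < 1) (hβq : β * q ≤ 1)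
    (hα0 : 0 < α) (hα1 : (2 / q) * (1 - β * q) < α) (hα2 : α ≤ 1) (k : ℕ) (g : ℤ → ℂ)
    (hg : Good q β k g) :
    ∃ X : ℕ, k + 4 ≤ X ∧ Good q β (k + 1) (convSeq g (bX X ((X : ℝ) ^ (-2 / α)))) := by
  obtain ⟨h1, h2, h3, h4, h5⟩ := hg
  obtain ⟨D, hD, hY⟩ := young_A hq (-β) g (by rwa [abs_neg, abs_of_nonneg hβ])
  set ε : ℝ := (1 / 2) ^ (k + 2) with hε
  have hε0 : 0 < ε := by positivity
  have hη : 0 < ε ^ q / (D + 1) := by positivity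
  obtain ⟨X, ⟨hX1, hX2⟩, hX3⟩ :=
    ((bX_small hq hβ hβq hα1 hα2 _ hη).and (eventually_ge_atTop (k + 4))).exists
  obtain ⟨hδ0, hδ1⟩ := delta_bound hα0 hα2 (show 2 ≤ X by omega)
  refine ⟨X, hX3, ?_⟩
  set δ := (X : ℝ) ^ (-2 / α) with hδ
  have hb := memA_bX X hδ0 hβ hβ1
  set d := fun n => bX X δ n - dlt n with hd
  obtain ⟨hc1, hc2⟩ := hY d hX1
  have hbd : convSeq g (bX X δ) = fun n => g n + convSeq g d n := by
    funext n
    have e1 := conv_summable g (bX X δ) (memA_summable hβ g h1) (memA_summable hβ _ hb) n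
    have hdl : MemA 1 β dlt := memA_finite (by norm_num) _ dlt_supp
    have e2 := conv_summable g dlt (memA_summable hβ g h1) (memA_summable hβ _ hdl) n
    have e3 : convSeq g d n = convSeq g (bX X δ) n - convSeq g dlt n := by
      unfold convSeq
      rw [← e1.tsum_sub e2]
      congr 1; funext j; simp only [hd]; ring
    rw [e3, conv_dlt]; ring
  have hnd : normA q (-β) (convSeq g d) ≤ ε := by
    unfold normA
    have : wSum q (-β) (convSeq g d) ≤ ε ^ q := by
      refine hc2.trans ((mul_le_mul_of_nonneg_left hX2 hD).trans ?_)
      rw [mul_div_assoc', div_le_iff₀ (by positivity)]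
      nlinarith [show 0 < ε ^ q by positivity]
    calc _ ≤ (ε ^ q) ^ (1 / q) :=
          Real.rpow_le_rpow (wSum_nonneg _ _ _) this (by positivity)
      _ = ε := by rw [← Real.rpow_mul hε0.le, mul_one_div_cancel (by linarith), Real.rpow_one]
  obtain ⟨ha1, ha2⟩ := normA_add hq (-β) g (convSeq g d) h2 hc1
  have p1 : ((1 : ℝ) / 2) ^ k = 4 * ε := by rw [hε]; ring
  have p2 : ((1 : ℝ) / 2) ^ (k + 1) = 2 * ε := by rw [hε]; ring
  refine ⟨memA_conv hβ _ _ h1 hb, ?_, ?_, ?_, ?_⟩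
  · rw [hbd]; exact ha1
  · rw [hbd, p2]; rw [p1] at h3; linarith
  · have hz := norm_zero_le_normA hq (-β) _ hc1
    have : convSeq g (bX X δ) 0 - 1 = (g 0 - 1) + convSeq g d 0 := by rw [hbd]; ring
    rw [this]
    refine (norm_add_le _ _).trans ?_
    rw [p2] at h4
    have : ((1 : ℝ) / 2) ^ (k + 1 + 1) = ε := by rw [hε]
    rw [this]; linarith
  · intro t
    obtain ⟨r, hr, er⟩ := h5 t
    obtain ⟨s, hs, es⟩ := bX_pos X hδ0 hδ1 t
    refine ⟨r * s, mul_nonneg hr hs, ?_⟩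
    rw [fSum_conv _ _ (memA_summable hβ g h1) (memA_summable hβ _ hb), er, es]
    push_cast; rfl

theorem exists_seq_good {q β α : ℝ} (hq : 1 ≤ q) (hβ : 0 ≤ β) (hβ1 : β < 1) (hβq : β * q ≤ 1)
    (hα0 : 0 < α) (hα1 : (2 / q) * (1 - β * q) < α) (hα2 : α ≤ 1) :
    ∃ (X : ℕ → ℕ) (g : ℕ → ℤ → ℂ), (∀ k, k + 4 ≤ X k) ∧ (∀ k, Good q β k (g k)) ∧
      ∀ j k, j < k → ∀ t, t ∉ KX (X j) ((X j : ℝ) ^ (-2 / α)) → fSum (g k) t = 0 := by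
  have step := good_step hq hβ hβ1 hβq hα0 hα1 hα2
  choose F hF1 hF2 using step
  let G : (k : ℕ) → {g : ℤ → ℂ // Good q β k g} := fun k =>
    Nat.rec (motive := fun k => {g : ℤ → ℂ // Good q β k g}) ⟨dlt, good_zero hq⟩
      (fun k g => ⟨_, hF2 k g.1 g.2⟩) k
  let X : ℕ → ℕ := fun k => F k (G k).1 (G k).2
  have hX : ∀ k, k + 4 ≤ X k := fun k => hF1 k _ _
  have hGs : ∀ k, (G (k + 1)).1 = convSeq (G k).1 (bX (X k) ((X k : ℝ) ^ (-2 / α))) :=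
    fun k => rfl
  refine ⟨X, fun k => (G k).1, hX, fun k => (G k).2, ?_⟩
  intro j k hjk t ht
  have hprod : ∀ k, fSum (G (k + 1)).1 t =
      fSum (G k).1 t * fSum (bX (X k) ((X k : ℝ) ^ (-2 / α))) t := by
    intro k
    obtain ⟨hδ0, hδ1⟩ := delta_bound hα0 hα2 (show 2 ≤ X k by have := hX k; omega)
    rw [hGs, fSum_conv _ _ (memA_summable hβ _ (G k).2.1)
      (memA_summable hβ _ (memA_bX (X k) hδ0 hβ hβ1))]
  induction k with
  | zero => omega
  | succ k ih =>
    show fSum (G (k + 1)).1 t = 0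
    rw [hprod]
    rcases Nat.lt_succ_iff_lt_or_eq.mp hjk with h | h
    · rw [show fSum (G k).1 t = 0 from ih h, zero_mul]
    · subst h
      obtain ⟨hδ0, hδ1⟩ := delta_bound hα0 hα2 (show 2 ≤ X j by have := hX j; omega)
      rw [bX_supp _ hδ0 hδ1 t ht, mul_zero]

theorem supp_compact (K : ℕ → Set (AddCircle (2 * Real.pi))) (hK : ∀ k, IsClosed (K k))
    (U : Set (AddCircle (2 * Real.pi))) (hU : IsOpen U) (h : (⋂ k, K k) ⊆ U) :
    ∃ n, ∀ t, t ∉ U → ∃ j, j < n ∧ t ∉ K j := by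
  have hc : IsCompact Uᶜ := hU.isClosed_compl.isCompact
  have := hc.elim_finite_subfamily_closed K hK (by
    ext t; simp only [mem_inter_iff, mem_compl_iff, mem_empty_iff_false, iff_false, not_and]
    exact fun ht h' => ht (h h'))
  obtain ⟨u, hu⟩ := this
  refine ⟨u.sup id + 1, fun t ht => ?_⟩
  by_contra hcon
  push Not at hcon
  have : t ∈ Uᶜ ∩ ⋂ i ∈ u, K i := by
    refine ⟨ht, ?_⟩
    simp only [mem_iInter]
    intro i hi
    exact hcon i (Nat.lt_succ_of_le (Finset.le_sup (f := id) hi))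
  rw [hu] at this
  exact this

theorem dimH_KX_le {α : ℝ} (hα0 : 0 < α) (X : ℕ → ℕ) (hX : ∀ k, k + 4 ≤ X k) :
    dimH (⋂ k, KX (X k) ((X k : ℝ) ^ (-2 / α))) ≤ ENNReal.ofReal α := by
  set s := ⋂ k, KX (X k) ((X k : ℝ) ^ (-2 / α)) with hs
  have hXt : Tendsto (fun k => (X k : ℝ)) atTop atTop := by
    apply tendsto_natCast_atTop_atTop.comp
    exact tendsto_atTop_mono (fun k => (by have := hX k; omega : k ≤ X k)) tendsto_id
  let r : ℕ → ℝ := fun k => 2 * (2 * π * (X k : ℝ) ^ (-2 / α))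
  have hr0 : ∀ k, 0 ≤ r k := fun k => by positivity
  have hrt : Tendsto (fun k => ENNReal.ofReal (r k)) atTop (𝓝 0) := by
    rw [← ENNReal.ofReal_zero]
    apply ENNReal.tendsto_ofReal
    have h1 : Tendsto (fun k => (X k : ℝ) ^ (-2 / α)) atTop (𝓝 0) := by
      have := (tendsto_rpow_neg_atTop (show 0 < 2 / α by positivity)).comp hXt
      refine this.congr fun k => ?_
      simp [neg_div]
    have := (h1.const_mul (2 * π)).const_mul 2
    simpa [r] using this
  let t : (k : ℕ) → (Fin (X k + 1) × Fin (X k + 1)) → Set (AddCircle (2 * Real.pi)) :=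
    fun k i => Metric.closedBall (ctr i.1 i.2) (2 * π * (X k : ℝ) ^ (-2 / α))
  have ht : ∀ k i, Metric.ediam (t k i) ≤ ENNReal.ofReal (r k) := by
    intro k i
    refine Metric.ediam_le_of_forall_dist_le fun x hx y hy => ?_
    have := dist_triangle_right x y (ctr i.1 i.2)
    have h1 := Metric.mem_closedBall.mp hx
    have h2 := Metric.mem_closedBall.mp hy
    simp only [r]; linarith
  have hst : ∀ k, s ⊆ ⋃ i, t k i := by
    intro k x hx
    have := mem_iInter.mp hx k
    simp only [KX, mem_iUnion, Finset.mem_product, Finset.mem_range, exists_prop] at this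
    obtain ⟨i, ⟨h1, h2⟩, h3⟩ := this
    exact mem_iUnion.mpr ⟨(⟨i.1, h1⟩, ⟨i.2, h2⟩), h3⟩
  borelize (AddCircle (2 * Real.pi))
  have hm := Measure.hausdorffMeasure_le_liminf_sum α s _ hrt t
    (Eventually.of_forall ht) (Eventually.of_forall hst)
  have hbound : ∀ k, ∑ i, Metric.ediam (t k i) ^ α ≤ ENNReal.ofReal (4 * (4 * π) ^ α) := by
    intro k
    have hXk : (4 : ℝ) ≤ X k := by have := hX k; exact_mod_cast (by omega : 4 ≤ X k)
    calc ∑ i, Metric.ediam (t k i) ^ α ≤ ∑ i : Fin (X k + 1) × Fin (X k + 1),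
          ENNReal.ofReal (r k ^ α) := by
          refine Finset.sum_le_sum fun i _ => ?_
          rw [← ENNReal.ofReal_rpow_of_nonneg (hr0 k) hα0.le]
          exact ENNReal.rpow_le_rpow (ht k i) hα0.le
      _ = ENNReal.ofReal (((X k : ℝ) + 1) * (X k + 1) * r k ^ α) := by
          rw [Finset.sum_const, Finset.card_univ, nsmul_eq_mul, Fintype.card_prod, Fintype.card_fin,
            ← ENNReal.ofReal_natCast, ← ENNReal.ofReal_mul (by positivity)]
          push_cast; rfl
      _ ≤ _ := by
          apply ENNReal.ofReal_le_ofReal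
          have e1 : r k ^ α = (4 * π) ^ α * ((X k : ℝ) ^ 2)⁻¹ := by
            have : r k = (4 * π) * (X k : ℝ) ^ (-2 / α) := by simp only [r]; ring
            rw [this, Real.mul_rpow (by positivity) (by positivity),
              ← Real.rpow_mul (by positivity), div_mul_cancel₀ _ hα0.ne',
              Real.rpow_neg (by positivity)]
            norm_cast
          rw [e1]
          have e2 : ((X k : ℝ) + 1) * (X k + 1) * ((X k : ℝ) ^ 2)⁻¹ ≤ 4 := by
            rw [← div_eq_mul_inv, div_le_iff₀ (by positivity)]; nlinarith
          have e3 : 0 ≤ (4 * π) ^ α := by positivity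
          nlinarith
  have hfin : μH[α] s ≠ ⊤ := by
    refine ne_top_of_le_ne_top (ENNReal.ofReal_ne_top (r := 4 * (4 * π) ^ α)) (hm.trans ?_)
    refine (liminf_le_liminf (v := fun _ => ENNReal.ofReal (4 * (4 * π) ^ α))
      (Eventually.of_forall hbound)).trans ?_
    simp
  have := dimH_le_of_hausdorffMeasure_ne_top (d := Real.toNNReal α) (s := s)
    (by rwa [Real.coe_toNNReal _ hα0.le])
  exact this

/-- parametrisation of the Cantor set of ratio `l` -/
def cphi (l : ℝ) (f : ℕ → Fin 2) : ℝ := ∑' n, (1 - l) * (((f n : ℕ) : ℝ) * l ^ n)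

theorem digit_le (f : ℕ → Fin 2) (n : ℕ) : ((f n : ℕ) : ℝ) ≤ 1 := by
  have := (f n).2
  exact_mod_cast (by omega : (f n : ℕ) ≤ 1)

theorem cterm_nonneg {l : ℝ} (h0 : 0 < l) (h1 : l < 1) (f : ℕ → Fin 2) (n : ℕ) :
    0 ≤ (1 - l) * (((f n : ℕ) : ℝ) * l ^ n) := by
  have : 0 < 1 - l := by linarith
  positivity

theorem cterm_le {l : ℝ} (h0 : 0 < l) (h1 : l < 1) (f : ℕ → Fin 2) (n : ℕ) :
    (1 - l) * (((f n : ℕ) : ℝ) * l ^ n) ≤ (1 - l) * l ^ n := by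
  apply mul_le_mul_of_nonneg_left _ (by linarith)
  exact mul_le_of_le_one_left (by positivity) (digit_le f n)

theorem csum_geom {l : ℝ} (h0 : 0 < l) (h1 : l < 1) : Summable fun n : ℕ => (1 - l) * l ^ n :=
  (summable_geometric_of_lt_one h0.le h1).mul_left _

theorem csummable {l : ℝ} (h0 : 0 < l) (h1 : l < 1) (f : ℕ → Fin 2) :
    Summable fun n => (1 - l) * (((f n : ℕ) : ℝ) * l ^ n) :=
  Summable.of_nonneg_of_le (cterm_nonneg h0 h1 f) (cterm_le h0 h1 f) (csum_geom h0 h1)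

theorem cphi_mem {l : ℝ} (h0 : 0 < l) (h1 : l < 1) (f : ℕ → Fin 2) : cphi l f ∈ Icc (0 : ℝ) 1 := by
  refine ⟨tsum_nonneg (cterm_nonneg h0 h1 f), ?_⟩
  have := (csummable h0 h1 f).tsum_le_tsum (cterm_le h0 h1 f) (csum_geom h0 h1)
  refine this.trans (le_of_eq ?_)
  rw [tsum_mul_left, tsum_geometric_of_lt_one h0.le h1, mul_inv_cancel₀ (by linarith)]

theorem cphi_cont {l : ℝ} (h0 : 0 < l) (h1 : l < 1) : Continuous (cphi l) := by
  unfold cphi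
  refine continuous_tsum (u := fun n : ℕ => (1 - l) * l ^ n) ?_ (csum_geom h0 h1) ?_
  · intro n
    have : Continuous fun f : ℕ → Fin 2 => ((f n : ℕ) : ℝ) :=
      (continuous_of_discreteTopology (f := fun i : Fin 2 => ((i : ℕ) : ℝ))).comp
        (continuous_apply n)
    fun_prop
  · intro n f
    rw [Real.norm_of_nonneg (cterm_nonneg h0 h1 f n)]
    exact cterm_le h0 h1 f n

theorem cphi_split {l : ℝ} (h0 : 0 < l) (h1 : l < 1) (f : ℕ → Fin 2) (n : ℕ) :
    cphi l f = ∑ i ∈ Finset.range n, (1 - l) * (((f i : ℕ) : ℝ) * l ^ i) +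
      l ^ n * cphi l (fun i => f (i + n)) := by
  unfold cphi
  rw [← (csummable h0 h1 f).sum_add_tsum_nat_add n, ← tsum_mul_left]
  congr 2
  funext i
  rw [pow_add]; ring

theorem cphi_le {l : ℝ} (h0 : 0 < l) (h1 : l < 1) (f g : ℕ → Fin 2) (n : ℕ)
    (h : ∀ i < n, f i = g i) : |cphi l f - cphi l g| ≤ l ^ n := by
  rw [cphi_split h0 h1 f n, cphi_split h0 h1 g n]
  have : ∑ i ∈ Finset.range n, (1 - l) * (((f i : ℕ) : ℝ) * l ^ i) =
      ∑ i ∈ Finset.range n, (1 - l) * (((g i : ℕ) : ℝ) * l ^ i) :=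
    Finset.sum_congr rfl fun i hi => by rw [h i (Finset.mem_range.mp hi)]
  rw [this, add_sub_add_left_eq_sub, ← mul_sub, abs_mul, abs_of_pos (pow_pos h0 n)]
  have a := cphi_mem h0 h1 (fun i => f (i + n))
  have b := cphi_mem h0 h1 (fun i => g (i + n))
  apply mul_le_of_le_one_right (by positivity)
  rw [abs_le]; constructor <;> linarith [a.1, a.2, b.1, b.2]

theorem cphi_gap0 {l : ℝ} (h0 : 0 < l) (h1 : l < 1) (f g : ℕ → Fin 2) (h : f 0 ≠ g 0) :
    1 - 2 * l ≤ |cphi l f - cphi l g| := by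
  wlog hfg : f 0 = 1 ∧ g 0 = 0 generalizing f g
  · rw [abs_sub_comm]
    apply this g f h.symm
    revert h hfg
    generalize f 0 = x
    generalize g 0 = y
    revert x y; decide
  rw [cphi_split h0 h1 f 1, cphi_split h0 h1 g 1]
  have a := cphi_mem h0 h1 (fun i => f (i + 1))
  have b := cphi_mem h0 h1 (fun i => g (i + 1))
  refine le_trans ?_ (le_abs_self _)
  simp only [Finset.range_one, Finset.sum_singleton, hfg.1, hfg.2, pow_zero, pow_one, mul_one,
    Fin.val_one, Fin.val_zero, Nat.cast_one, Nat.cast_zero, mul_zero]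
  nlinarith [a.1, a.2, b.1, b.2]

theorem cphi_gap {l : ℝ} (h0 : 0 < l) (h1 : l < 1) (f g : ℕ → Fin 2) (n : ℕ)
    (h : ∀ i < n, f i = g i) (hn : f n ≠ g n) :
    l ^ n * (1 - 2 * l) ≤ |cphi l f - cphi l g| := by
  rw [cphi_split h0 h1 f n, cphi_split h0 h1 g n]
  have : ∑ i ∈ Finset.range n, (1 - l) * (((f i : ℕ) : ℝ) * l ^ i) =
      ∑ i ∈ Finset.range n, (1 - l) * (((g i : ℕ) : ℝ) * l ^ i) :=
    Finset.sum_congr rfl fun i hi => by rw [h i (Finset.mem_range.mp hi)]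
  rw [this, add_sub_add_left_eq_sub, ← mul_sub, abs_mul, abs_of_pos (pow_pos h0 n)]
  exact mul_le_mul_of_nonneg_left (cphi_gap0 h0 h1 _ _ (by simpa using hn)) (by positivity)

theorem first_diff (f g : ℕ → Fin 2) (h : f ≠ g) :
    ∃ n, (∀ i < n, f i = g i) ∧ f n ≠ g n := by
  have hex : ∃ n, f n ≠ g n := Function.ne_iff.mp h
  classical
  exact ⟨Nat.find hex, fun i hi => not_not.mp (Nat.find_min hex hi), Nat.find_spec hex⟩

theorem dimH_cantor {α : ℝ} (h0 : 0 < α) (h1 : α < 1) :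
    dimH (range (cphi ((2 : ℝ) ^ (-1 / α)))) = ENNReal.ofReal α := by
  set l : ℝ := (2 : ℝ) ^ (-1 / α) with hl
  have hl0 : 0 < l := by positivity
  have hl2 : l < 1 / 2 := by
    have : l < (2 : ℝ) ^ (-1 : ℝ) := by
      apply Real.rpow_lt_rpow_of_exponent_lt (by norm_num)
      rw [div_lt_iff₀ h0]; linarith
    rw [Real.rpow_neg_one] at this; linarith
  have hl1 : l < 1 := by linarith
  have hlα : l ^ α = 1 / 2 := by
    rw [hl, ← Real.rpow_mul (by norm_num), div_mul_cancel₀ _ h0.ne', Real.rpow_neg_one]; norm_num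
  have hlnα : ∀ n : ℕ, (l ^ n) ^ α = (1 / 2) ^ n := by
    intro n
    rw [← hlα, ← Real.rpow_natCast, ← Real.rpow_mul hl0.le, mul_comm, Real.rpow_mul hl0.le,
      Real.rpow_natCast]
  have hcoe : ((Real.toNNReal α : NNReal) : ℝ≥0∞) = ENNReal.ofReal α := rfl
  apply le_antisymm
  · -- upper bound by covering
    have hrt : Tendsto (fun n : ℕ => ENNReal.ofReal (l ^ n)) atTop (𝓝 0) := by
      rw [← ENNReal.ofReal_zero]
      exact ENNReal.tendsto_ofReal (tendsto_pow_atTop_nhds_zero_of_lt_one hl0.le hl1)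
    let t : (n : ℕ) → (Fin n → Fin 2) → Set ℝ :=
      fun n i => cphi l '' {f | ∀ j : Fin n, f j = i j}
    have ht : ∀ n i, Metric.ediam (t n i) ≤ ENNReal.ofReal (l ^ n) := by
      intro n i
      refine Metric.ediam_le_of_forall_dist_le ?_
      rintro _ ⟨f, hf, rfl⟩ _ ⟨g, hg, rfl⟩
      rw [Real.dist_eq]
      refine cphi_le hl0 hl1 f g n fun j hj => ?_
      exact (hf ⟨j, hj⟩).trans (hg ⟨j, hj⟩).symm
    have hst : ∀ n, range (cphi l) ⊆ ⋃ i, t n i := by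
      rintro n _ ⟨f, rfl⟩
      exact mem_iUnion.mpr ⟨fun j => f j, f, fun j => rfl, rfl⟩
    have hm := Measure.hausdorffMeasure_le_liminf_sum α (range (cphi l)) _ hrt t
      (Eventually.of_forall ht) (Eventually.of_forall hst)
    have hbound : ∀ n, ∑ i, Metric.ediam (t n i) ^ α ≤ 1 := by
      intro n
      calc ∑ i, Metric.ediam (t n i) ^ α ≤ ∑ i : Fin n → Fin 2, ENNReal.ofReal ((1 / 2) ^ n) := by
            refine Finset.sum_le_sum fun i _ => ?_
            rw [← hlnα, ← ENNReal.ofReal_rpow_of_nonneg (by positivity) h0.le]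
            exact ENNReal.rpow_le_rpow (ht n i) h0.le
        _ = ENNReal.ofReal (2 ^ n * (1 / 2) ^ n) := by
            rw [Finset.sum_const, Finset.card_univ, nsmul_eq_mul, Fintype.card_fun,
              Fintype.card_fin, Fintype.card_fin,
              ← ENNReal.ofReal_natCast, ← ENNReal.ofReal_mul (by positivity)]
            push_cast; rfl
        _ ≤ 1 := by
            rw [← mul_pow]; norm_num
    have hfin : μH[α] (range (cphi l)) ≠ ⊤ := by
      refine ne_top_of_le_ne_top ENNReal.one_ne_top (hm.trans ?_)
      refine (liminf_le_liminf (v := fun _ => (1 : ℝ≥0∞))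
        (Eventually.of_forall hbound)).trans ?_
      simp
    exact dimH_le_of_hausdorffMeasure_ne_top (d := Real.toNNReal α)
      (by rwa [Real.coe_toNNReal _ h0.le])
  · have hgap : 0 < 1 - 2 * l := by linarith
    have hinj : Function.Injective (cphi l) := by
      intro f g hfg
      by_contra hne
      obtain ⟨n, hn1, hn2⟩ := first_diff f g hne
      have := cphi_gap hl0 hl1 f g n hn1 hn2
      rw [hfg, sub_self, abs_zero] at this
      have : 0 < l ^ n * (1 - 2 * l) := by positivity
      linarith
    let h : ℝ → ℝ := fun x => Real.ofDigits (Function.invFun (cphi l) x)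
    have hh : ∀ f, h (cphi l f) = Real.ofDigits f := fun f => by
      simp only [h]; rw [Function.leftInverse_invFun hinj f]
    set K : ℝ := ((1 - 2 * l)⁻¹) ^ α with hK
    have hhol : HolderOnWith (Real.toNNReal K) (Real.toNNReal α) h (range (cphi l)) := by
      rintro _ ⟨f, rfl⟩ _ ⟨g, rfl⟩
      rw [hh, hh]
      by_cases hfg : f = g
      · subst hfg; simp
      obtain ⟨n, hn1, hn2⟩ := first_diff f g hfg
      have e1 := cphi_gap hl0 hl1 f g n hn1 hn2
      have e2 := Real.abs_ofDigits_sub_ofDigits_le hn1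
      rw [edist_dist, edist_dist, Real.dist_eq, Real.dist_eq, Real.coe_toNNReal _ h0.le,
        ENNReal.ofReal_rpow_of_nonneg (abs_nonneg _) h0.le]
      change _ ≤ ENNReal.ofReal K * _
      rw [← ENNReal.ofReal_mul (by positivity)]
      apply ENNReal.ofReal_le_ofReal
      refine e2.trans ?_
      have : ((2 : ℕ) : ℝ) ^ n = 2 ^ n := by norm_num
      rw [this, hK, ← Real.mul_rpow (by positivity) (abs_nonneg _),
        show ((2 : ℝ) ^ n)⁻¹ = (l ^ n) ^ α by rw [hlnα]; simp]
      apply Real.rpow_le_rpow (by positivity) _ h0.le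
      rw [inv_mul_eq_div, le_div_iff₀ hgap]; exact e1
    have hd := hhol.dimH_image_le (Real.toNNReal_pos.mpr h0)
    have hsub : Icc (0 : ℝ) 1 ⊆ h '' range (cphi l) := by
      intro y hy
      obtain ⟨f, -, hf⟩ := Real.ofDigits_SurjOn (b := 2) (by norm_num) hy
      exact ⟨_, ⟨f, rfl⟩, (hh f).trans hf⟩
    have h1 : dimH (Icc (0 : ℝ) 1) = 1 := by
      rw [Real.dimH_of_nonempty_interior (by simp)]; simp
    have := (h1 ▸ dimH_mono hsub).trans hd
    rw [hcoe, ENNReal.le_div_iff_mul_le (Or.inl (by simpa using h0)) (Or.inl (by simp)),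
      one_mul] at this
    exact this

theorem exists_real_cantor {α : ℝ} (h0 : 0 < α) (h1 : α ≤ 1) :
    ∃ C : Set ℝ, IsCompact C ∧ C ⊆ Icc 0 1 ∧ dimH C = ENNReal.ofReal α := by
  rcases h1.lt_or_eq with h | rfl
  · have hl0 : 0 < (2 : ℝ) ^ (-1 / α) := by positivity
    have hl1 : (2 : ℝ) ^ (-1 / α) < 1 :=
      Real.rpow_lt_one_of_one_lt_of_neg (by norm_num) (div_neg_of_neg_of_pos (by norm_num) h0)
    refine ⟨_, isCompact_range (cphi_cont hl0 hl1), ?_, dimH_cantor h0 h⟩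
    rintro _ ⟨f, rfl⟩
    exact cphi_mem hl0 hl1 f
  · refine ⟨Icc 0 1, isCompact_Icc, le_rfl, ?_⟩
    rw [Real.dimH_of_nonempty_interior (by simp)]; simp

theorem exists_circle_cantor {α : ℝ} (h0 : 0 < α) (h1 : α ≤ 1) :
    ∃ C : Set (AddCircle (2 * Real.pi)), IsClosed C ∧ dimH C = ENNReal.ofReal α := by
  obtain ⟨C, hC, hsub, hd⟩ := exists_real_cantor h0 h1
  have hiso : Isometry (fun x : C => ((x : ℝ) : AddCircle (2 * Real.pi))) := by
    refine Isometry.of_dist_eq fun x y => ?_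
    have hx := hsub x.2
    have hy := hsub y.2
    rw [dist_eq_norm, ← AddCircle.coe_sub, Subtype.dist_eq, Real.dist_eq,
      (AddCircle.norm_coe_eq_abs_iff (2 * π) (by positivity)).mpr]
    rw [abs_of_pos (show 0 < 2 * π by positivity)]
    have : |(x : ℝ) - y| ≤ 1 := by
      rw [abs_le]; constructor <;> linarith [hx.1, hx.2, hy.1, hy.2]
    linarith [Real.pi_gt_three]
  refine ⟨(fun x : ℝ => (x : AddCircle (2 * Real.pi))) '' C,
    (hC.image (AddCircle.continuous_mk' _)).isClosed, ?_⟩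
  rw [← hd]
  have e1 := hiso.dimH_image univ
  have e2 := (isometry_subtype_coe (s := C)).dimH_image univ
  rw [image_univ] at e1 e2
  rw [Subtype.range_coe] at e2
  rw [e2, ← e1]
  congr 1
  ext z; simp

/-- Theorem A(3): if `1 < p < 2`, `β > 0`, `βq ≤ 1` where
`q = p/(p-1)`, then for every `α` with `(2/q)(1-βq) < α ≤ 1` there is a closed
set `E ⊆ 𝕋` with `dim E = α` such that every `f ∈ A^1_β(𝕋)` with `Z(f) = E`
is not cyclic in `A^p_β(𝕋)`. -/
theorem stmt2 (p q β : ℝ) (hp1 : 1 < p) (hp2 : p < 2) (hβ : 0 < β)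
    (hq : q = p / (p - 1)) (hβq : β * q ≤ 1)
    (α : ℝ) (hα1 : (2 / q) * (1 - β * q) < α) (hα2 : α ≤ 1) :
    ∃ E : Set (AddCircle (2 * Real.pi)), IsClosed E ∧
      dimH E = ENNReal.ofReal α ∧
      ∀ c : ℤ → ℂ, MemA 1 β c → zeroSet c = E → ¬ IsCyclicA p β c := by
  have hp0 : 0 < p - 1 := by linarith
  have hq2 : 2 < q := by
    rw [hq, lt_div_iff₀ hp0]; linarith
  have hq1 : 1 ≤ q := by linarith
  have hpq : p.HolderConjugate q := by
    rw [Real.holderConjugate_iff]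
    refine ⟨hp1, ?_⟩
    rw [hq]; field_simp; ring
  have hβ1 : β < 1 := by nlinarith
  have hα0 : 0 < α := by
    refine lt_of_le_of_lt ?_ hα1
    have : 0 ≤ 1 - β * q := by linarith
    positivity
  obtain ⟨X, g, hX, hg, hs⟩ := exists_seq_good hq1 hβ.le hβ1 hβq hα0 hα1 hα2
  obtain ⟨C, hC, hCd⟩ := exists_circle_cantor hα0 hα2
  have hKc : ∀ k, IsClosed (KX (X k) ((X k : ℝ) ^ (-2 / α))) := fun k => KX_closed _ _
  refine ⟨(⋂ k, KX (X k) ((X k : ℝ) ^ (-2 / α))) ∪ C, (isClosed_iInter hKc).union hC, ?_, ?_⟩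
  · rw [dimH_union, hCd]
    exact max_eq_right (dimH_KX_le hα0 X hX)
  · intro c hc hz
    have hpw : ∀ k : ℕ, (0 : ℝ) < (1 / 2) ^ k := fun k => by positivity
    refine noncyclic hpq hβ.le _ 2 g (fun k => (hg k).1) (fun k => (hg k).2.1)
      (fun k => by linarith [(hg k).2.2.1, hpw k]) (fun k => (hg k).2.2.2.2) ?_ ?_ ?_ c hc hz
    · intro k
      have h1 := (hg k).2.2.2.1
      have h2 := norm_sub_norm_le (1 : ℂ) (g k 0)
      rw [norm_sub_rev, norm_one] at h2
      linarith [hpw (k + 1)]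
    · intro k
      have h1 := (hg k).2.2.2.1
      have h2 := norm_sub_norm_le (g k 0) (1 : ℂ)
      rw [norm_one] at h2
      linarith [hpw (k + 1)]
    · intro U hU hEU
      obtain ⟨n, hn⟩ := supp_compact _ hKc U hU (subset_union_left.trans hEU)
      refine ⟨n, fun t ht => ?_⟩
      obtain ⟨j, hj, hj2⟩ := hn t ht
      exact hs j n hj t hj2

end
end
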